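/- Assume GRH for χ, i.e. every zero s of L(s,χ) with 0 < Re(s) < 1 satisfies Re(s) = 1/2. Then for every ε > 0 there exists T₀ ≥ 4 such that for every ρ' ∈ ℂ with ζ'(ρ') = 0, Re(ρ') ≥ 1 and Im(ρ') ≥ T₀, one has |L(ρ',χ)|·log(log(Im ρ')) ≥ (π²·e^{−C₀}/12)·∏_{p prime, p ∣ q} (p+1)/p − ε. (Equivalently, liminf over critical points ρ' of ζ with Re(ρ') ≥ 1 and Im(ρ') → ∞ of |L(ρ',χ)|·log log Im(ρ') is at least (π²e^{−C₀}/12)·∏_{p∣q}(p+1)/p.) -/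

import Mathlib

open Complex DirichletCharacter ArithmeticFunction Finset

/-- The function `n ↦ log n / n` on primes, extended by zero. -/
noncomputable def primeLogDiv (n : ℕ) : ℝ := if n.Prime then Real.log n / n else 0

/-- The function `n ↦ 1 / n` on primes, extended by zero. -/
noncomputable def primeRecip (n : ℕ) : ℝ := if n.Prime then 1 / (n : ℝ) else 0

lemma log_factorial_eq_sum_factorization (N : ℕ) :
    Real.log (N.factorial : ℝ) =
      ∑ p ∈ (Icc 0 N).filter Nat.Prime, (N.factorial.factorization p : ℝ) * Real.log p := by
  have h := Nat.prod_factorization_pow_eq_self (Nat.factorial_ne_zero N)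
  conv_lhs => rw [← h]
  rw [Finsupp.prod, Nat.cast_prod, Real.log_prod]
  · simp only [Nat.cast_pow, Real.log_pow]
    apply Finset.sum_subset
    · intro p hp
      have hp' : p ∈ N.factorial.primeFactors := by simpa using hp
      have := Nat.prime_of_mem_primeFactors hp'
      simp only [mem_filter, mem_Icc, zero_le, true_and]
      exact ⟨(this.dvd_factorial).1 (Nat.dvd_of_mem_primeFactors hp'), this⟩
    · intro p _ hp
      simp [Finsupp.notMem_support_iff.1 hp]
  · intro p hp
    have hp' : p ∈ N.factorial.primeFactors := by simpa using hp
    have := (Nat.prime_of_mem_primeFactors hp').pos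
    positivity

lemma summable_log_div_sq_sub : Summable fun n : ℕ => Real.log n / (n * (n - 1 : ℝ)) := by
  have h : Summable fun n : ℕ => 4 * (1 / (n : ℝ) ^ (3 / 2 : ℝ)) :=
    (Real.summable_one_div_nat_rpow.2 (by norm_num)).mul_left 4
  refine Summable.of_norm_bounded h fun n => ?_
  rcases Nat.lt_or_ge n 2 with hn | hn
  · interval_cases n <;> simp
  · have hn' : (2 : ℝ) ≤ n := by exact_mod_cast hn
    have hlog : Real.log n ≤ 2 * (n : ℝ) ^ (1 / 2 : ℝ) := by
      have := Real.log_le_rpow_div (x := n) (by positivity) (ε := 1 / 2) (by norm_num)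
      linarith
    have h0 : 0 ≤ Real.log n := Real.log_nonneg (by linarith)
    rw [Real.norm_of_nonneg (by apply div_nonneg h0; nlinarith)]
    have e : (n : ℝ) ^ (3 / 2 : ℝ) * (n : ℝ) ^ (1 / 2 : ℝ) = n ^ 2 := by
      rw [← Real.rpow_add (by positivity)]; norm_num
    have hp : 0 < (n : ℝ) ^ (3 / 2 : ℝ) := by positivity
    rw [mul_one_div, div_le_div_iff₀ (by nlinarith) hp]
    calc Real.log n * (n : ℝ) ^ (3 / 2 : ℝ)
        ≤ 2 * (n : ℝ) ^ (1 / 2 : ℝ) * (n : ℝ) ^ (3 / 2 : ℝ) := by gcongr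
      _ = 2 * n ^ 2 := by rw [← e]; ring
      _ ≤ 4 * (n * (n - 1)) := by nlinarith

lemma sum_primeLogDiv_eq (N : ℕ) :
    ∑ k ∈ Icc 0 N, primeLogDiv k = ∑ p ∈ (Icc 0 N).filter Nat.Prime, Real.log p / p := by
  simp only [primeLogDiv, ← Finset.sum_filter]

/-- Mertens' first theorem along the integers. -/
lemma exists_abs_sum_primeLogDiv_sub_log_le_nat :
    ∃ C : ℝ, ∀ N : ℕ, 1 ≤ N → |∑ k ∈ Icc 0 N, primeLogDiv k - Real.log N| ≤ C := by
  refine ⟨max (∑' n : ℕ, Real.log n / (n * (n - 1 : ℝ)) + 1) (Real.log 4), fun N hN => ?_⟩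
  have hN0 : (0 : ℝ) < N := by exact_mod_cast hN
  have hfac := log_factorial_eq_sum_factorization N
  have hup : Real.log (N.factorial : ℝ) ≤ N * Real.log N := by
    rw [← Real.log_pow]
    apply Real.log_le_log (by positivity)
    exact_mod_cast Nat.factorial_le_pow N
  have hlow : N * Real.log N - N ≤ Real.log (N.factorial : ℝ) := by
    have := Real.log_le_log (by positivity)
      (Real.pow_div_factorial_le_exp (x := N) hN0.le N)
    rw [Real.log_exp, Real.log_div (by positivity) (by positivity), Real.log_pow] at this
    linarith
  rw [sum_primeLogDiv_eq]
  set P := (Icc 0 N).filter Nat.Prime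
  rw [abs_le]
  constructor
  · have h1 : Real.log (N.factorial : ℝ) ≤ N * ∑ p ∈ P, Real.log p / p +
        N * ∑ p ∈ P, Real.log p / (p * (p - 1 : ℝ)) := by
      rw [hfac, mul_sum, mul_sum, ← sum_add_distrib]
      apply sum_le_sum
      intro p hp
      have hp' : p.Prime := (mem_filter.1 hp).2
      have h2 : (2 : ℝ) ≤ p := by exact_mod_cast hp'.two_le
      have h3 := Nat.factorization_factorial_le_div_pred hp' N
      have h4 : (N.factorial.factorization p : ℝ) ≤ N / (p - 1 : ℝ) := by
        have : ((N / (p - 1) : ℕ) : ℝ) ≤ (N : ℝ) / ((p - 1 : ℕ) : ℝ) := Nat.cast_div_le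
        rw [Nat.cast_sub hp'.one_le, Nat.cast_one] at this
        exact le_trans (by exact_mod_cast h3) this
      have h5 : 0 ≤ Real.log p := Real.log_nonneg (by linarith)
      calc (N.factorial.factorization p : ℝ) * Real.log p ≤ N / (p - 1 : ℝ) * Real.log p := by
            gcongr
        _ = _ := by
            have : (p : ℝ) - 1 ≠ 0 := by linarith
            have : (p : ℝ) ≠ 0 := by linarith
            field_simp
            ring
    have h2 : ∑ p ∈ P, Real.log p / (p * (p - 1 : ℝ)) ≤
        ∑' n : ℕ, Real.log n / (n * (n - 1 : ℝ)) := by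
      apply summable_log_div_sq_sub.sum_le_tsum
      intro n _
      rcases n.eq_zero_or_pos with rfl | hn
      · simp
      have : (1 : ℝ) ≤ n := by exact_mod_cast hn
      apply div_nonneg (Real.log_nonneg this)
      nlinarith
    have h3 : N * Real.log N - N ≤ N * (∑ p ∈ P, Real.log p / p +
        ∑' n : ℕ, Real.log n / (n * (n - 1 : ℝ))) := by
      nlinarith
    have h4 : Real.log N - 1 ≤ ∑ p ∈ P, Real.log p / p +
        ∑' n : ℕ, Real.log n / (n * (n - 1 : ℝ)) := by
      by_contra! h
      nlinarith
    linarith [le_max_left (∑' n : ℕ, Real.log n / (n * (n - 1 : ℝ)) + 1) (Real.log 4)]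
  · have h1 : N * ∑ p ∈ P, Real.log p / p - ∑ p ∈ P, Real.log p ≤
        Real.log (N.factorial : ℝ) := by
      rw [hfac, mul_sum, ← sum_sub_distrib]
      apply sum_le_sum
      intro p hp
      have hp' : p.Prime := (mem_filter.1 hp).2
      have h2 : (2 : ℝ) ≤ p := by exact_mod_cast hp'.two_le
      have h5 : 0 ≤ Real.log p := Real.log_nonneg (by linarith)
      have h3 : N / p ≤ N.factorial.factorization p := by
        rw [← hp'.pow_dvd_iff_le_factorization (Nat.factorial_ne_zero N)]
        calc p ^ (N / p) ∣ (p * (N / p)).factorial := by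
              rw [hp'.pow_dvd_iff_le_factorization (Nat.factorial_ne_zero _),
                Nat.factorization_factorial_mul hp']
              omega
          _ ∣ N.factorial := Nat.factorial_dvd_factorial (Nat.mul_div_le N p)
      have h4 : (N : ℝ) / p - 1 ≤ N.factorial.factorization p := by
        have : (N : ℝ) / p < ((N / p : ℕ) : ℝ) + 1 := by
          rw [div_lt_iff₀ (by linarith)]
          have := Nat.lt_mul_div_succ N hp'.pos
          rw [mul_comm] at this
          exact_mod_cast this
        have h6 : ((N / p : ℕ) : ℝ) ≤ N.factorial.factorization p := by exact_mod_cast h3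
        linarith
      calc (N : ℝ) * (Real.log p / p) - Real.log p = (N / p - 1) * Real.log p := by ring
        _ ≤ _ := by gcongr
    have h2 : ∑ p ∈ P, Real.log p ≤ Real.log 4 * N := by
      have := Chebyshev.theta_le_log4_mul_x hN0.le
      rwa [Chebyshev.theta_eq_sum_Icc, Nat.floor_natCast] at this
    have h4 : ∑ p ∈ P, Real.log p / p - Real.log N ≤ Real.log 4 := by
      by_contra! h
      nlinarith
    exact h4.trans (le_max_right _ _)

/-- Mertens' first theorem. -/
lemma exists_abs_sum_primeLogDiv_sub_log_le :
    ∃ C : ℝ, 0 ≤ C ∧ ∀ x : ℝ, 1 ≤ x →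
      |∑ k ∈ Icc 0 ⌊x⌋₊, primeLogDiv k - Real.log x| ≤ C := by
  obtain ⟨C, hC⟩ := exists_abs_sum_primeLogDiv_sub_log_le_nat
  have hC0 : 0 ≤ C := (abs_nonneg _).trans (hC 1 le_rfl)
  refine ⟨C + Real.log 2, by positivity, fun x hx => ?_⟩
  have hf : 1 ≤ ⌊x⌋₊ := (Nat.one_le_floor_iff x).2 hx
  have hf' : (1 : ℝ) ≤ ⌊x⌋₊ := by exact_mod_cast hf
  have h1 := hC _ hf
  have h2 : Real.log ⌊x⌋₊ ≤ Real.log x :=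
    Real.log_le_log (by linarith) (Nat.floor_le (by linarith))
  have h3 : Real.log x ≤ Real.log ⌊x⌋₊ + Real.log 2 := by
    rw [← Real.log_mul (by linarith) (by norm_num)]
    apply Real.log_le_log (by linarith)
    linarith [Nat.lt_floor_add_one x]
  rw [abs_le] at h1 ⊢
  constructor <;> linarith [h1.1, h1.2]

/-- The sum of the reciprocals of the primes up to `x`. -/
noncomputable def primeRecipSum (x : ℝ) : ℝ := ∑ k ∈ Icc 0 ⌊x⌋₊, primeRecip k

lemma primeRecip_nonneg (n : ℕ) : 0 ≤ primeRecip n := by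
  unfold primeRecip; split_ifs <;> positivity

lemma primeRecip_eq_inv_log_mul (n : ℕ) :
    primeRecip n = (Real.log n)⁻¹ * primeLogDiv n := by
  unfold primeRecip primeLogDiv
  split_ifs with h
  · have : Real.log n ≠ 0 := (Real.log_pos (by exact_mod_cast h.one_lt)).ne'
    field_simp
  · simp

lemma primeRecipSum_sub_eq {x y : ℝ} (hxy : x ≤ y) :
    primeRecipSum y - primeRecipSum x = ∑ k ∈ Ioc ⌊x⌋₊ ⌊y⌋₊, primeRecip k := by
  have h := Nat.floor_le_floor hxy
  unfold primeRecipSum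
  rw [sub_eq_iff_eq_add', ← Finset.sum_union]
  · congr 1
    ext k
    simp only [mem_union, mem_Icc, mem_Ioc]
    omega
  · rw [Finset.disjoint_left]
    intro k
    simp only [mem_Icc, mem_Ioc]
    omega

lemma hasDerivAt_inv_log {t : ℝ} (ht : 1 < t) :
    HasDerivAt (fun t => (Real.log t)⁻¹) (-t⁻¹ / Real.log t ^ 2) t :=
  (Real.hasDerivAt_log (by linarith)).fun_inv (Real.log_pos ht).ne'

lemma continuousOn_deriv_inv_log {x y : ℝ} (hx : 1 < x) :
    ContinuousOn (fun t : ℝ => -t⁻¹ / Real.log t ^ 2) (Set.Icc x y) := by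
  intro t ht
  have h1 : 1 < t := hx.trans_le ht.1
  have h2 : Real.log t ≠ 0 := (Real.log_pos h1).ne'
  have h3 : t ≠ 0 := by linarith
  apply ContinuousAt.continuousWithinAt
  fun_prop (disch := first | assumption | exact pow_ne_zero _ h2)

/-- Mertens' second theorem, in Cauchy form. -/
lemma exists_abs_primeRecipSum_sub_le :
    ∃ C : ℝ, 0 ≤ C ∧ ∀ x y : ℝ, 2 ≤ x → x ≤ y →
      |primeRecipSum y - primeRecipSum x - (Real.log (Real.log y) - Real.log (Real.log x))| ≤
        C / Real.log x := by
  obtain ⟨C, hC0, hC⟩ := exists_abs_sum_primeLogDiv_sub_log_le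
  refine ⟨2 * C, by positivity, fun x y hx hxy => ?_⟩
  have hx1 : 1 < x := by linarith
  have hlx : 0 < Real.log x := Real.log_pos hx1
  have hly : 0 < Real.log y := Real.log_pos (by linarith)
  have hd : ∀ t ∈ Set.Icc x y,
      HasDerivAt (fun t => (Real.log t)⁻¹) (-t⁻¹ / Real.log t ^ 2) t := fun t ht =>
    hasDerivAt_inv_log (hx1.trans_le ht.1)
  have hint : MeasureTheory.IntegrableOn (fun t : ℝ => -t⁻¹ / Real.log t ^ 2) (Set.Icc x y) :=
    (continuousOn_deriv_inv_log hx1).integrableOn_Icc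
  have hint' : MeasureTheory.IntegrableOn (deriv fun t => (Real.log t)⁻¹) (Set.Icc x y) :=
    hint.congr_fun (fun t ht => ((hd t ht).deriv).symm) measurableSet_Icc
  have habel := sum_mul_eq_sub_sub_integral_mul primeLogDiv (f := fun t => (Real.log t)⁻¹)
    (by linarith : (0 : ℝ) ≤ x) hxy (fun t ht => (hd t ht).differentiableAt) hint'
  have hI := integrableOn_mul_sum_Icc (m := 0) primeLogDiv (by linarith : (0 : ℝ) ≤ x) hint'
  rw [primeRecipSum_sub_eq hxy]
  simp_rw [primeRecip_eq_inv_log_mul]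
  rw [habel]
  set A : ℝ → ℝ := fun t => ∑ k ∈ Icc 0 ⌊t⌋₊, primeLogDiv k with hA
  have hg : MeasureTheory.IntegrableOn (fun t : ℝ => (t * Real.log t)⁻¹) (Set.Ioc x y) := by
    apply (ContinuousOn.integrableOn_Icc _).mono_set Set.Ioc_subset_Icc_self
    intro t ht
    have h1 : 1 < t := hx1.trans_le ht.1
    have h2 : Real.log t ≠ 0 := (Real.log_pos h1).ne'
    have h3 : t ≠ 0 := by linarith
    apply ContinuousAt.continuousWithinAt
    fun_prop (disch := first | assumption | exact mul_ne_zero h3 h2)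
  have hgi : ∫ t in Set.Ioc x y, (t * Real.log t)⁻¹ =
      Real.log (Real.log y) - Real.log (Real.log x) := by
    rw [← intervalIntegral.integral_of_le hxy]
    apply intervalIntegral.integral_eq_sub_of_hasDerivAt
    · intro t ht
      rw [Set.uIcc_of_le hxy] at ht
      have h1 : 1 < t := hx1.trans_le ht.1
      have := (Real.hasDerivAt_log (by linarith)).log (Real.log_pos h1).ne'
      rwa [div_eq_mul_inv, ← mul_inv] at this
    · rwa [intervalIntegrable_iff_integrableOn_Ioc_of_le hxy]
  have hfi : ∫ t in Set.Ioc x y, -(-t⁻¹ / Real.log t ^ 2) =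
      (Real.log x)⁻¹ - (Real.log y)⁻¹ := by
    rw [MeasureTheory.integral_neg, ← intervalIntegral.integral_of_le hxy,
      intervalIntegral.integral_eq_sub_of_hasDerivAt (f := fun t => (Real.log t)⁻¹)]
    · ring
    · intro t ht
      rw [Set.uIcc_of_le hxy] at ht
      exact hd t ht
    · rw [intervalIntegrable_iff_integrableOn_Ioc_of_le hxy]
      exact hint.mono_set Set.Ioc_subset_Icc_self
  have hI2 := hI.mono_set (Set.Ioc_subset_Icc_self (a := x) (b := y))
  have hdiff : |(∫ t in Set.Ioc x y, deriv (fun t => (Real.log t)⁻¹) t * A t) +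
      (Real.log (Real.log y) - Real.log (Real.log x))| ≤
      C * ((Real.log x)⁻¹ - (Real.log y)⁻¹) := by
    rw [← hgi, ← MeasureTheory.integral_add hI2 hg, ← hfi, ← MeasureTheory.integral_const_mul,
      ← Real.norm_eq_abs]
    apply MeasureTheory.norm_integral_le_of_norm_le
    · exact ((hint.mono_set Set.Ioc_subset_Icc_self).neg).const_mul C
    · rw [MeasureTheory.ae_restrict_iff' measurableSet_Ioc]
      refine Filter.Eventually.of_forall fun t ht => ?_
      have h1 : 1 < t := hx1.trans ht.1
      have h2 : 0 < Real.log t := Real.log_pos h1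
      rw [(hd t (Set.Ioc_subset_Icc_self ht)).deriv]
      have e : -t⁻¹ / Real.log t ^ 2 * A t + (t * Real.log t)⁻¹ =
          -t⁻¹ / Real.log t ^ 2 * (A t - Real.log t) := by
        field_simp
        ring
      rw [e, norm_mul, mul_comm, Real.norm_eq_abs, Real.norm_eq_abs]
      have h3 : |-t⁻¹ / Real.log t ^ 2| = -(-t⁻¹ / Real.log t ^ 2) := by
        apply abs_of_nonpos
        rw [neg_div]
        have : 0 ≤ t⁻¹ / Real.log t ^ 2 := by positivity
        linarith
      rw [h3]
      have h4 : 0 ≤ -(-t⁻¹ / Real.log t ^ 2) := h3 ▸ abs_nonneg _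
      exact mul_le_mul_of_nonneg_right (hC t h1.le) h4
  have hy' : |(Real.log y)⁻¹ * A y - 1| ≤ C * (Real.log y)⁻¹ := by
    have e : (Real.log y)⁻¹ * A y - 1 = (A y - Real.log y) * (Real.log y)⁻¹ := by field_simp
    rw [e, abs_mul, abs_of_pos (inv_pos.2 hly)]
    exact mul_le_mul_of_nonneg_right (hC y (by linarith)) (inv_pos.2 hly).le
  have hx' : |(Real.log x)⁻¹ * A x - 1| ≤ C * (Real.log x)⁻¹ := by
    have e : (Real.log x)⁻¹ * A x - 1 = (A x - Real.log x) * (Real.log x)⁻¹ := by field_simp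
    rw [e, abs_mul, abs_of_pos (inv_pos.2 hlx)]
    exact mul_le_mul_of_nonneg_right (hC x (by linarith)) (inv_pos.2 hlx).le
  rw [abs_le] at *
  rw [div_eq_mul_inv]
  constructor <;> linarith [hdiff.1, hdiff.2, hy'.1, hy'.2, hx'.1, hx'.2]

/-- Mertens' second theorem. -/
lemma exists_tendsto_primeRecipSum_sub_log_log :
    ∃ c : ℝ, Filter.Tendsto (fun x => primeRecipSum x - Real.log (Real.log x)) Filter.atTop
      (nhds c) := by
  obtain ⟨C, hC0, hC⟩ := exists_abs_primeRecipSum_sub_le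
  apply cauchy_map_iff_exists_tendsto.1
  rw [Metric.cauchy_iff]
  refine ⟨inferInstance, fun ε hε => ?_⟩
  have ht : Filter.Tendsto (fun x => C / Real.log x) Filter.atTop (nhds 0) :=
    Filter.Tendsto.div_atTop tendsto_const_nhds Real.tendsto_log_atTop
  obtain ⟨x, hx, hx2⟩ :=
    ((ht.eventually (gt_mem_nhds (half_pos hε))).and (Filter.eventually_ge_atTop 2)).exists
  refine ⟨_, Filter.image_mem_map (Filter.Ici_mem_atTop x), ?_⟩
  rintro _ ⟨y, hy, rfl⟩ _ ⟨z, hz, rfl⟩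
  have h1 := hC x y hx2 hy
  have h2 := hC x z hx2 hz
  rw [Real.dist_eq, abs_lt]
  rw [abs_le] at h1 h2
  constructor <;> linarith [h1.1, h1.2, h2.1, h2.2]

section Laplace

variable {a l : ℕ → ℝ}

lemma integrableOn_exp_neg_mul_ite (c d : ℝ) :
    MeasureTheory.IntegrableOn (fun v : ℝ => Real.exp (-v) * if d ≤ v then c else 0)
      (Set.Ioi 0) := by
  have h : (fun v : ℝ => Real.exp (-v) * if d ≤ v then c else 0) =
      (Set.Ici d).indicator fun v => Real.exp (-v) * c := by
    ext v
    by_cases hv : d ≤ v <;> simp [hv]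
  rw [h]
  exact MeasureTheory.Integrable.indicator ((integrableOn_exp_neg_Ioi 0).mul_const c)
    measurableSet_Ici

lemma integral_exp_neg_mul_ite (c : ℝ) {d : ℝ} (hd : 0 ≤ d) :
    ∫ v in Set.Ioi (0 : ℝ), Real.exp (-v) * (if d ≤ v then c else 0) = c * Real.exp (-d) := by
  have h : (fun v : ℝ => Real.exp (-v) * if d ≤ v then c else 0) =
      (Set.Ici d).indicator fun v => Real.exp (-v) * c := by
    ext v
    by_cases hv : d ≤ v <;> simp [hv]
  rw [h, MeasureTheory.integral_congr_ae
    (MeasureTheory.ae_restrict_of_ae (indicator_ae_eq_of_ae_eq_set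
      (MeasureTheory.Ioi_ae_eq_Ici (a := d)).symm)),
    MeasureTheory.setIntegral_indicator measurableSet_Ioi,
    Set.inter_eq_right.2 (Set.Ioi_subset_Ioi hd), MeasureTheory.integral_mul_const,
    integral_exp_neg_Ioi, mul_comm]

lemma integrableOn_and_tsum_mul_exp_neg_eq (ha : ∀ n, 0 ≤ a n) (hl : ∀ n, 0 ≤ l n)
    (hs : Summable fun n => a n * Real.exp (-l n)) {A : ℝ → ℝ}
    (hA : ∀ v, 0 < v → HasSum (fun n => if l n ≤ v then a n else 0) (A v)) :
    MeasureTheory.IntegrableOn (fun v => Real.exp (-v) * A v) (Set.Ioi 0) ∧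
      ∑' n, a n * Real.exp (-l n) = ∫ v in Set.Ioi 0, Real.exp (-v) * A v := by
  set F : ℕ → ℝ → ℝ := fun n v => Real.exp (-v) * if l n ≤ v then a n else 0 with hF
  have hF0 : ∀ n v, 0 ≤ F n v := fun n v => by
    simp only [hF]
    have := ha n
    split_ifs <;> positivity
  have hFi : ∀ n, MeasureTheory.IntegrableOn (F n) (Set.Ioi 0) := fun n =>
    integrableOn_exp_neg_mul_ite _ _
  have hFint : ∀ n, ∫ v in Set.Ioi 0, F n v = a n * Real.exp (-l n) := fun n =>
    integral_exp_neg_mul_ite _ (hl n)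
  have hFA : ∀ v ∈ Set.Ioi (0 : ℝ), HasSum (fun n => F n v) (Real.exp (-v) * A v) :=
    fun v hv => (hA v hv).mul_left _
  have hmeas : MeasureTheory.AEStronglyMeasurable (fun v => Real.exp (-v) * A v)
      (MeasureTheory.volume.restrict (Set.Ioi 0)) := by
    refine aestronglyMeasurable_of_tendsto_ae Filter.atTop
      (f := fun N v => ∑ n ∈ range N, F n v) (fun N => ?_) ?_
    · exact (MeasureTheory.integrable_finsetSum _ fun n _ => hFi n).aestronglyMeasurable
    · rw [MeasureTheory.ae_restrict_iff' measurableSet_Ioi]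
      exact Filter.Eventually.of_forall fun v hv => (hFA v hv).tendsto_sum_nat
  have hfin : ∫⁻ v in Set.Ioi 0, ‖Real.exp (-v) * A v‖ₑ =
      ENNReal.ofReal (∑' n, a n * Real.exp (-l n)) := by
    calc ∫⁻ v in Set.Ioi 0, ‖Real.exp (-v) * A v‖ₑ
        = ∫⁻ v in Set.Ioi 0, ∑' n, ENNReal.ofReal (F n v) := by
          apply MeasureTheory.setLIntegral_congr_fun measurableSet_Ioi
          intro v hv
          have h := hFA v hv
          simp only
          rw [← h.tsum_eq, ← ENNReal.ofReal_tsum_of_nonneg (fun n => hF0 n v) h.summable,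
            Real.enorm_of_nonneg (tsum_nonneg fun n => hF0 n v)]
      _ = ∑' n, ∫⁻ v in Set.Ioi 0, ENNReal.ofReal (F n v) :=
          MeasureTheory.lintegral_tsum fun n => (hFi n).aemeasurable.ennreal_ofReal
      _ = ∑' n, ENNReal.ofReal (a n * Real.exp (-l n)) := by
          congr 1 with n
          rw [← hFint, MeasureTheory.ofReal_integral_eq_lintegral_ofReal (hFi n)
            (Filter.Eventually.of_forall (hF0 n))]
      _ = _ := (ENNReal.ofReal_tsum_of_nonneg
          (fun n => mul_nonneg (ha n) (Real.exp_pos _).le) hs).symm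
  have hint : MeasureTheory.IntegrableOn (fun v => Real.exp (-v) * A v) (Set.Ioi 0) :=
    ⟨hmeas, by rw [MeasureTheory.HasFiniteIntegral, hfin]; exact ENNReal.ofReal_lt_top⟩
  refine ⟨hint, ?_⟩
  have h1 := MeasureTheory.hasSum_integral_of_summable_integral_norm hFi (by
    simp only [Real.norm_of_nonneg (hF0 _ _), hFint]
    exact hs)
  simp only [hFint] at h1
  rw [h1.tsum_eq]
  exact MeasureTheory.setIntegral_congr_fun measurableSet_Ioi fun v hv => (hFA v hv).tsum_eq

end Laplace

lemma hasSum_ite_primeRecip {δ : ℝ} (hδ : 0 < δ) {v : ℝ} (hv : 0 < v) :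
    HasSum (fun n : ℕ => if δ * Real.log n ≤ v then primeRecip n else 0)
      (primeRecipSum (Real.exp (v / δ))) := by
  have h : primeRecipSum (Real.exp (v / δ)) = ∑ n ∈ Icc 0 ⌊Real.exp (v / δ)⌋₊,
      if δ * Real.log n ≤ v then primeRecip n else 0 := by
    refine sum_congr rfl fun n hn => ?_
    rw [if_pos]
    rcases n.eq_zero_or_pos with rfl | hn0
    · simpa using hv.le
    have h1 : (n : ℝ) ≤ Real.exp (v / δ) :=
      (Nat.le_floor_iff (Real.exp_pos _).le).1 (mem_Icc.1 hn).2
    have h2 := Real.log_le_log (by exact_mod_cast hn0) h1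
    rw [Real.log_exp, le_div_iff₀ hδ] at h2
    linarith
  rw [h]
  apply hasSum_sum_of_ne_finset_zero
  intro n hn
  rw [if_neg]
  simp only [mem_Icc, zero_le, true_and, not_le] at hn
  have h1 : Real.exp (v / δ) < n := (Nat.floor_lt (Real.exp_pos _).le).1 hn
  have h2 := Real.log_lt_log (Real.exp_pos _) h1
  rw [Real.log_exp, div_lt_iff₀ hδ] at h2
  linarith

lemma primeRecip_mul_exp {δ : ℝ} (n : ℕ) :
    primeRecip n * Real.exp (-(δ * Real.log n)) =
      if n.Prime then (n : ℝ) ^ (-(1 + δ)) else 0 := by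
  unfold primeRecip
  split_ifs with h
  · have hn : (0 : ℝ) < n := by exact_mod_cast h.pos
    rw [neg_add, Real.rpow_add hn, Real.rpow_neg_one, Real.rpow_def_of_pos hn]
    congr 2 <;> ring
  · simp

lemma summable_prime_rpow_neg {s : ℝ} (hs : 1 < s) :
    Summable fun n : ℕ => if n.Prime then (n : ℝ) ^ (-s) else 0 := by
  refine Summable.of_nonneg_of_le (fun n => ?_) (fun n => ?_)
    (Real.summable_nat_rpow.2 (by linarith : -s < -1))
  · split_ifs <;> positivity
  · split_ifs
    · exact le_rfl
    · positivity

/-- The sum of `p ^ (-(1 + δ))` as a Laplace transform. -/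
lemma tsum_prime_rpow_neg_eq_integral {δ : ℝ} (hδ : 0 < δ) :
    MeasureTheory.IntegrableOn
      (fun v => Real.exp (-v) * primeRecipSum (Real.exp (v / δ))) (Set.Ioi 0) ∧
    ∑' n : ℕ, (if n.Prime then (n : ℝ) ^ (-(1 + δ)) else 0) =
      ∫ v in Set.Ioi 0, Real.exp (-v) * primeRecipSum (Real.exp (v / δ)) := by
  have := integrableOn_and_tsum_mul_exp_neg_eq (a := primeRecip)
    (l := fun n => δ * Real.log n) (A := fun v => primeRecipSum (Real.exp (v / δ)))
    primeRecip_nonneg (fun n => mul_nonneg hδ.le (Real.log_natCast_nonneg n))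
    (by simp_rw [primeRecip_mul_exp]; exact summable_prime_rpow_neg (by linarith))
    (fun v hv => hasSum_ite_primeRecip hδ hv)
  simpa only [primeRecip_mul_exp] using this

lemma neg_log_one_sub_exp_neg_eq_integral {δ : ℝ} (hδ : 0 < δ) :
    MeasureTheory.IntegrableOn
      (fun v => Real.exp (-v) * (harmonic ⌊v / δ⌋₊ : ℝ)) (Set.Ioi 0) ∧
    -Real.log (1 - Real.exp (-δ)) =
      ∫ v in Set.Ioi 0, Real.exp (-v) * (harmonic ⌊v / δ⌋₊ : ℝ) := by
  have hlog : HasSum (fun n : ℕ => 1 / (n : ℝ) * Real.exp (-(δ * n)))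
      (-Real.log (1 - Real.exp (-δ))) := by
    have h1 : |Real.exp (-δ)| < 1 := by
      rw [abs_of_pos (Real.exp_pos _)]
      simpa using hδ
    have h2 := Real.hasSum_pow_div_log_of_abs_lt_one h1
    rw [← hasSum_nat_add_iff' 1]
    simp only [range_one, sum_singleton, Nat.cast_zero, div_zero, zero_mul, sub_zero]
    have e : (fun n : ℕ => 1 / ((n + 1 : ℕ) : ℝ) * Real.exp (-(δ * ((n + 1 : ℕ) : ℝ)))) =
        fun n : ℕ => Real.exp (-δ) ^ (n + 1) / (n + 1) := by
      ext n
      rw [← Real.exp_nat_mul, one_div_mul_eq_div]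
      push_cast
      congr 2
      ring
    rwa [e]
  have := integrableOn_and_tsum_mul_exp_neg_eq (a := fun n => 1 / (n : ℝ))
    (l := fun n => δ * n) (A := fun v => (harmonic ⌊v / δ⌋₊ : ℝ))
    (fun n => by positivity) (fun n => by positivity) hlog.summable ?_
  · rwa [hlog.tsum_eq] at this
  · intro v hv
    have h : (harmonic ⌊v / δ⌋₊ : ℝ) = ∑ n ∈ Icc 1 ⌊v / δ⌋₊,
        if δ * n ≤ v then 1 / (n : ℝ) else 0 := by
      rw [harmonic_eq_sum_Icc]
      push_cast
      refine sum_congr rfl fun n hn => ?_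
      have h1 : (n : ℝ) ≤ v / δ :=
        (Nat.le_floor_iff (by positivity)).1 (mem_Icc.1 hn).2
      rw [le_div_iff₀ hδ] at h1
      rw [if_pos (by linarith), one_div]
    rw [h]
    apply hasSum_sum_of_ne_finset_zero
    intro n hn
    rcases n.eq_zero_or_pos with rfl | hn0
    · simp
    rw [if_neg]
    simp only [mem_Icc, not_and, not_le] at hn
    have h1 : v / δ < n := (Nat.floor_lt (by positivity)).1 (hn hn0)
    rw [div_lt_iff₀ hδ] at h1
    linarith

lemma primeRecipSum_mono : Monotone primeRecipSum := by
  intro x y hxy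
  have := primeRecipSum_sub_eq hxy
  have h : 0 ≤ ∑ k ∈ Ioc ⌊x⌋₊ ⌊y⌋₊, primeRecip k := sum_nonneg fun k _ => primeRecip_nonneg k
  linarith

lemma primeRecipSum_nonneg (x : ℝ) : 0 ≤ primeRecipSum x :=
  sum_nonneg fun k _ => primeRecip_nonneg k

lemma tendsto_harmonic_floor_sub_log :
    Filter.Tendsto (fun t : ℝ => (harmonic ⌊t⌋₊ : ℝ) - Real.log t) Filter.atTop
      (nhds Real.eulerMascheroniConstant) := by
  have h1 := Real.tendsto_harmonic_sub_log.comp (tendsto_nat_floor_atTop (α := ℝ))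
  have h2 : Filter.Tendsto (fun t : ℝ => Real.log ((⌊t⌋₊ : ℝ) / t)) Filter.atTop (nhds 0) := by
    have := (Real.continuousAt_log one_ne_zero).tendsto.comp
      (tendsto_nat_floor_div_atTop (R := ℝ))
    simpa [Function.comp_def] using this
  have h3 := h1.add h2
  rw [add_zero] at h3
  refine h3.congr' ?_
  filter_upwards [Filter.eventually_ge_atTop 1] with t ht
  have : (⌊t⌋₊ : ℝ) ≠ 0 := by
    have := (Nat.one_le_floor_iff t).2 ht
    positivity
  simp only [Function.comp]
  rw [Real.log_div this (by linarith)]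
  ring

lemma harmonic_mono : Monotone fun n => (harmonic n : ℝ) := by
  refine monotone_nat_of_le_succ fun n => ?_
  rw [harmonic_succ]
  push_cast
  have : (0 : ℝ) ≤ ((n : ℝ) + 1)⁻¹ := by positivity
  linarith

lemma exists_abs_primeRecipSum_exp_sub_harmonic_le :
    ∃ B : ℝ, ∀ t : ℝ, 0 ≤ t → |primeRecipSum (Real.exp t) - (harmonic ⌊t⌋₊ : ℝ)| ≤ B := by
  obtain ⟨c, hc⟩ := exists_tendsto_primeRecipSum_sub_log_log
  have h1 := (hc.comp Real.tendsto_exp_atTop).sub tendsto_harmonic_floor_sub_log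
  have h2 := h1.abs.eventually (gt_mem_nhds (lt_add_one _))
  obtain ⟨T, hT⟩ := Filter.eventually_atTop.1 h2
  have hH : ∀ n, (0 : ℝ) ≤ harmonic n := fun n => by
    have := harmonic_mono (Nat.zero_le n)
    simpa using this
  refine ⟨max (primeRecipSum (Real.exp T) + harmonic ⌊T⌋₊)
    (|c - Real.eulerMascheroniConstant| + 1), fun t ht => ?_⟩
  rcases le_total t T with h | h
  · apply le_max_of_le_left
    have e1 := primeRecipSum_mono (Real.exp_le_exp.2 h)
    have e2 := harmonic_mono (Nat.floor_le_floor h)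
    simp only at e2
    rw [abs_le]
    constructor <;> linarith [primeRecipSum_nonneg (Real.exp t), hH ⌊t⌋₊,
      primeRecipSum_nonneg (Real.exp T), hH ⌊T⌋₊]
  · apply le_max_of_le_right
    have := (hT t h).le
    simpa using this

open Filter Topology in
lemma tendsto_tsum_prime_rpow_add_log {c : ℝ}
    (hc : Tendsto (fun x => primeRecipSum x - Real.log (Real.log x)) atTop (𝓝 c)) :
    Tendsto (fun δ : ℝ => ∑' n : ℕ, (if n.Prime then (n : ℝ) ^ (-(1 + δ)) else 0) +
      Real.log (1 - Real.exp (-δ))) (𝓝[>] 0) (𝓝 (c - Real.eulerMascheroniConstant)) := by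
  obtain ⟨B, hB⟩ := exists_abs_primeRecipSum_exp_sub_harmonic_le
  have hlim : Tendsto (fun δ : ℝ => ∫ v in Set.Ioi (0 : ℝ), Real.exp (-v) *
      (primeRecipSum (Real.exp (v / δ)) - (harmonic ⌊v / δ⌋₊ : ℝ))) (𝓝[>] 0)
      (𝓝 (∫ v in Set.Ioi (0 : ℝ), Real.exp (-v) * (c - Real.eulerMascheroniConstant))) := by
    refine MeasureTheory.tendsto_integral_filter_of_dominated_convergence
      (fun v => Real.exp (-v) * B) ?_ ?_ ((integrableOn_exp_neg_Ioi 0).mul_const B) ?_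
    · filter_upwards [self_mem_nhdsWithin] with δ hδ
      have h := (tsum_prime_rpow_neg_eq_integral hδ).1.sub
        (neg_log_one_sub_exp_neg_eq_integral hδ).1
      refine h.aestronglyMeasurable.congr (Eventually.of_forall fun v => ?_)
      simp only [Pi.sub_apply]
      ring
    · filter_upwards [self_mem_nhdsWithin] with δ hδ
      rw [MeasureTheory.ae_restrict_iff' measurableSet_Ioi]
      refine Eventually.of_forall fun v hv => ?_
      rw [norm_mul, Real.norm_of_nonneg (Real.exp_pos _).le]
      exact mul_le_mul_of_nonneg_left (hB _ (div_nonneg hv.le hδ.le)) (Real.exp_pos _).le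
    · rw [MeasureTheory.ae_restrict_iff' measurableSet_Ioi]
      refine Eventually.of_forall fun v hv => ?_
      apply Tendsto.const_mul
      have ht : Tendsto (fun δ : ℝ => v / δ) (𝓝[>] 0) atTop := by
        simp_rw [div_eq_mul_inv]
        exact tendsto_inv_nhdsGT_zero.const_mul_atTop hv
      have h1 := ((hc.comp Real.tendsto_exp_atTop).sub tendsto_harmonic_floor_sub_log).comp ht
      simpa [Function.comp_def] using h1
  rw [MeasureTheory.integral_mul_const, integral_exp_neg_Ioi, neg_zero, Real.exp_zero,
    one_mul] at hlim
  refine hlim.congr' ?_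
  filter_upwards [self_mem_nhdsWithin] with δ hδ
  have h1 := tsum_prime_rpow_neg_eq_integral hδ
  have h2 := neg_log_one_sub_exp_neg_eq_integral hδ
  simp_rw [mul_sub]
  rw [MeasureTheory.integral_sub h1.1 h2.1, ← h1.2, ← h2.2]
  ring

/-- The function `n ↦ -log (1 - n ^ (-s))` on primes, extended by zero. -/
noncomputable def primeLogEuler (s : ℝ) (n : ℕ) : ℝ :=
  if n.Prime then -Real.log (1 - (n : ℝ) ^ (-s)) else 0

lemma prime_rpow_neg_le_half {n : ℕ} (hn : n.Prime) {s : ℝ} (hs : 1 ≤ s) :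
    (n : ℝ) ^ (-s) ≤ 1 / 2 := by
  have h2 : (2 : ℝ) ≤ n := by exact_mod_cast hn.two_le
  calc (n : ℝ) ^ (-s) ≤ (n : ℝ) ^ (-1 : ℝ) :=
        Real.rpow_le_rpow_of_exponent_le (by linarith) (by linarith)
    _ = 1 / n := by rw [Real.rpow_neg_one, one_div]
    _ ≤ 1 / 2 := by gcongr

lemma le_neg_log_one_sub {x : ℝ} (hx : x < 1) : x ≤ -Real.log (1 - x) := by
  linarith [Real.log_le_sub_one_of_pos (by linarith : 0 < 1 - x)]

lemma neg_log_one_sub_le {x : ℝ} (hx : x ≤ 1 / 2) :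
    -Real.log (1 - x) ≤ x + 2 * x ^ 2 := by
  have h := Real.one_sub_inv_le_log_of_pos (by linarith : 0 < 1 - x)
  have e : (1 - x)⁻¹ ≤ 1 + x + 2 * x ^ 2 := by
    rw [inv_le_iff_one_le_mul₀ (by linarith)]
    nlinarith [sq_nonneg x]
  linarith

lemma primeLogEuler_sub_nonneg {s : ℝ} (hs : 1 ≤ s) (n : ℕ) :
    0 ≤ primeLogEuler s n - (if n.Prime then (n : ℝ) ^ (-s) else 0) := by
  unfold primeLogEuler
  split_ifs with hn
  · linarith [le_neg_log_one_sub (by linarith [prime_rpow_neg_le_half hn hs] :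
      (n : ℝ) ^ (-s) < 1)]
  · simp

lemma primeLogEuler_sub_le {s : ℝ} (hs : 1 ≤ s) (n : ℕ) :
    primeLogEuler s n - (if n.Prime then (n : ℝ) ^ (-s) else 0) ≤ 2 * (n : ℝ) ^ (-2 : ℝ) := by
  unfold primeLogEuler
  split_ifs with hn
  · have h1 := neg_log_one_sub_le (prime_rpow_neg_le_half hn hs)
    have h3 : (1 : ℝ) ≤ n := by exact_mod_cast hn.one_le
    have h2 : ((n : ℝ) ^ (-s)) ^ 2 ≤ (n : ℝ) ^ (-2 : ℝ) := by
      rw [← Real.rpow_natCast, ← Real.rpow_mul (by positivity)]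
      apply Real.rpow_le_rpow_of_exponent_le h3
      push_cast
      linarith
    linarith
  · simp only [sub_zero]
    positivity

lemma summable_two_mul_rpow_neg_two : Summable fun n : ℕ => 2 * (n : ℝ) ^ (-2 : ℝ) :=
  (Real.summable_nat_rpow.2 (by norm_num)).mul_left 2

lemma summable_primeLogEuler_sub {s : ℝ} (hs : 1 ≤ s) :
    Summable fun n : ℕ => primeLogEuler s n - (if n.Prime then (n : ℝ) ^ (-s) else 0) :=
  Summable.of_nonneg_of_le (primeLogEuler_sub_nonneg hs) (primeLogEuler_sub_le hs)
    summable_two_mul_rpow_neg_two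

lemma summable_primeLogEuler {s : ℝ} (hs : 1 < s) : Summable (primeLogEuler s) := by
  have := (summable_primeLogEuler_sub hs.le).add (summable_prime_rpow_neg hs)
  simpa using this

open Filter Topology in
lemma tendsto_tsum_primeLogEuler_sub :
    Tendsto (fun δ : ℝ => ∑' n : ℕ, (primeLogEuler (1 + δ) n -
      (if n.Prime then (n : ℝ) ^ (-(1 + δ)) else 0))) (𝓝[>] 0)
      (𝓝 (∑' n : ℕ, (primeLogEuler 1 n - primeRecip n))) := by
  refine tendsto_tsum_of_dominated_convergence summable_two_mul_rpow_neg_two (fun n => ?_) ?_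
  · unfold primeLogEuler primeRecip
    split_ifs with hn
    · have h0 : (0 : ℝ) < n := by exact_mod_cast hn.pos
      have h1 : Tendsto (fun δ : ℝ => (n : ℝ) ^ (-(1 + δ))) (𝓝[>] 0) (𝓝 ((n : ℝ) ^ (-1 : ℝ))) := by
        have : ContinuousAt (fun δ : ℝ => (n : ℝ) ^ (-(1 + δ))) 0 := by
          apply ContinuousAt.rpow continuousAt_const (by fun_prop)
          exact Or.inl h0.ne'
        have h := this.tendsto.mono_left (nhdsWithin_le_nhds (s := Set.Ioi 0))
        simpa using h
      have h2 : (1 - (n : ℝ) ^ (-1 : ℝ)) ≠ 0 := by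
        linarith [prime_rpow_neg_le_half hn le_rfl]
      have h3 := ((h1.const_sub 1).log h2).neg.sub h1
      rwa [show (n : ℝ) ^ (-1 : ℝ) = 1 / n by rw [Real.rpow_neg_one, one_div]] at h3 ⊢
    · simp
  · filter_upwards [self_mem_nhdsWithin] with δ hδ n
    have hδ' : 0 < δ := hδ
    rw [Real.norm_of_nonneg (primeLogEuler_sub_nonneg (by linarith) n)]
    exact primeLogEuler_sub_le (by linarith) n

lemma riemannZeta_eq_exp_tsum_primeLogEuler {s : ℝ} (hs : 1 < s) :
    riemannZeta s = ((Real.exp (∑' n, primeLogEuler s n) : ℝ) : ℂ) := by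
  rw [← riemannZeta_eulerProduct_exp_log (s := (s : ℂ)) (by simpa using hs)]
  push_cast
  congr 1
  have h : (fun n : ℕ => ((primeLogEuler s n : ℝ) : ℂ)) =
      Set.indicator {p : ℕ | p.Prime} fun n : ℕ => -Complex.log (1 - (n : ℂ) ^ (-(s : ℂ))) := by
    ext n
    unfold primeLogEuler
    simp only [Set.indicator, Set.mem_ofPred_eq]
    split_ifs with hn
    · have := prime_rpow_neg_le_half hn hs.le
      push_cast
      rw [Complex.ofReal_log (by linarith)]
      push_cast
      rw [Complex.ofReal_cpow (by positivity)]
      push_cast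
      rfl
    · simp
  rw [h]
  exact tsum_subtype {p : ℕ | p.Prime} fun n : ℕ => -Complex.log (1 - (n : ℂ) ^ (-(s : ℂ)))

open Filter Topology in
lemma tendsto_tsum_primeLogEuler_add_log :
    Tendsto (fun δ : ℝ => ∑' n, primeLogEuler (1 + δ) n + Real.log δ) (𝓝[>] 0) (𝓝 0) := by
  have h1 : Tendsto (fun δ : ℝ => (1 + δ : ℂ)) (𝓝[>] 0) (𝓝[≠] 1) := by
    apply tendsto_nhdsWithin_of_tendsto_nhds_of_eventually_within
    · have : ContinuousAt (fun δ : ℝ => (1 + δ : ℂ)) 0 := by fun_prop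
      have h := this.tendsto.mono_left (nhdsWithin_le_nhds (s := Set.Ioi 0))
      simpa using h
    · filter_upwards [self_mem_nhdsWithin] with δ hδ
      have : δ ≠ 0 := ne_of_gt hδ
      simpa using this
  have h2 := (riemannZeta_residue_one.comp h1).norm
  have h3 := h2.log (by simp)
  simp only [norm_one, Real.log_one] at h3
  refine h3.congr' ?_
  filter_upwards [self_mem_nhdsWithin] with δ hδ
  have hδ' : 0 < δ := hδ
  have := riemannZeta_eq_exp_tsum_primeLogEuler (s := 1 + δ) (by linarith)
  rw [Complex.ofReal_add, Complex.ofReal_one] at this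
  simp only [Function.comp, this, add_sub_cancel_left]
  rw [norm_mul, Complex.norm_real, Complex.norm_real,
    Real.norm_of_nonneg hδ'.le, Real.norm_of_nonneg (Real.exp_pos _).le,
    Real.log_mul hδ'.ne' (Real.exp_pos _).ne', Real.log_exp, add_comm]

open Filter Topology in
lemma tendsto_log_one_sub_exp_neg_sub_log :
    Tendsto (fun δ : ℝ => Real.log (1 - Real.exp (-δ)) - Real.log δ) (𝓝[>] 0) (𝓝 0) := by
  have h0 : HasDerivAt (fun δ : ℝ => -Real.exp (-δ)) 1 0 := by
    have := ((hasDerivAt_id (0 : ℝ)).neg.exp).fun_neg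
    simpa using this
  have h1 := h0.tendsto_slope_zero_right
  have h2 := h1.log one_ne_zero
  rw [Real.log_one] at h2
  refine h2.congr' ?_
  filter_upwards [self_mem_nhdsWithin] with δ hδ
  have hδ' : 0 < δ := hδ
  have h3 : Real.exp (-δ) < 1 := by simpa using hδ'
  simp only [zero_add, neg_zero, Real.exp_zero, smul_eq_mul]
  rw [show -Real.exp (-δ) - -1 = 1 - Real.exp (-δ) by ring,
    Real.log_mul (inv_ne_zero hδ'.ne') (by linarith), Real.log_inv]
  ring

open Filter Topology in
/-- Mertens' third theorem, in logarithmic form. -/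
lemma tendsto_sum_primeLogEuler_sub_log_log :
    Tendsto (fun x : ℝ => ∑ n ∈ Icc 0 ⌊x⌋₊, primeLogEuler 1 n - Real.log (Real.log x)) atTop
      (𝓝 Real.eulerMascheroniConstant) := by
  obtain ⟨c, hc⟩ := exists_tendsto_primeRecipSum_sub_log_log
  set H := ∑' n : ℕ, (primeLogEuler 1 n - primeRecip n) with hH
  have hconst : c - Real.eulerMascheroniConstant = 0 - H + 0 := by
    refine tendsto_nhds_unique (tendsto_tsum_prime_rpow_add_log hc) ?_
    have h1 := (tendsto_tsum_primeLogEuler_add_log.sub tendsto_tsum_primeLogEuler_sub).add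
      tendsto_log_one_sub_exp_neg_sub_log
    refine h1.congr' ?_
    filter_upwards [self_mem_nhdsWithin] with δ hδ
    have hδ' : 0 < δ := hδ
    rw [(summable_primeLogEuler (by linarith : 1 < 1 + δ)).tsum_sub
      (summable_prime_rpow_neg (by linarith : 1 < 1 + δ))]
    ring
  have hone : ∀ n : ℕ, primeRecip n = if n.Prime then (n : ℝ) ^ (-1 : ℝ) else 0 := fun n => by
    unfold primeRecip
    rw [Real.rpow_neg_one, one_div]
  have hsum : Summable fun n : ℕ => primeLogEuler 1 n - primeRecip n := by
    simp_rw [hone]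
    exact summable_primeLogEuler_sub le_rfl
  have h2 : Tendsto (fun x : ℝ => ∑ n ∈ Icc 0 ⌊x⌋₊, (primeLogEuler 1 n - primeRecip n)) atTop
      (𝓝 H) := by
    have := (hsum.hasSum.tendsto_sum_nat.comp (tendsto_add_atTop_nat 1)).comp
      (tendsto_nat_floor_atTop (α := ℝ))
    refine this.congr fun x => ?_
    simp only [Function.comp, Nat.range_succ_eq_Icc_zero]
  have h3 := hc.add h2
  rw [show c + H = Real.eulerMascheroniConstant by linarith] at h3
  refine h3.congr fun x => ?_
  rw [primeRecipSum, sum_sub_distrib]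
  ring

lemma integral_exp_neg_mul_linear (A B : ℝ) (hA : 0 < A) (hB : 0 ≤ B) :
    MeasureTheory.IntegrableOn (fun v : ℝ => Real.exp (-v) * ((v - A) / A + B)) (Set.Ioi A) ∧
    ∫ v in Set.Ioi A, Real.exp (-v) * ((v - A) / A + B) = Real.exp (-A) * (1 / A + B) := by
  have hd : ∀ v : ℝ, HasDerivAt (fun v : ℝ => -Real.exp (-v) * ((v - A) / A + 1 / A + B))
      (Real.exp (-v) * ((v - A) / A + B)) v := by
    intro v
    have h1 : HasDerivAt (fun v : ℝ => -Real.exp (-v)) (Real.exp (-v)) v := by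
      have := ((hasDerivAt_id v).fun_neg.exp).fun_neg
      simpa using this
    have h2 : HasDerivAt (fun v : ℝ => (v - A) / A + 1 / A + B) (1 / A) v :=
      ((((hasDerivAt_id v).sub_const A).div_const A).add_const _).add_const _
    refine (h1.fun_mul h2).congr_deriv ?_
    ring
  have hpos : ∀ v ∈ Set.Ioi A, 0 ≤ Real.exp (-v) * ((v - A) / A + B) := fun v hv => by
    have : 0 ≤ (v - A) / A := div_nonneg (sub_nonneg.2 (le_of_lt hv)) hA.le
    positivity
  have hlim : Filter.Tendsto (fun v : ℝ => -Real.exp (-v) * ((v - A) / A + 1 / A + B))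
      Filter.atTop (nhds 0) := by
    have h1 : Filter.Tendsto (fun v : ℝ => Real.exp (-v)) Filter.atTop (nhds 0) :=
      Real.tendsto_exp_neg_atTop_nhds_zero
    have h2 : Filter.Tendsto (fun v : ℝ => v * Real.exp (-v)) Filter.atTop (nhds 0) := by
      simpa using Real.tendsto_pow_mul_exp_neg_atTop_nhds_zero 1
    have h3 := (h2.const_mul (-(1 / A))).sub (h1.const_mul (-1 + 1 / A + B))
    simp only [mul_zero, sub_zero] at h3
    refine h3.congr fun v => ?_
    have e : (v - A) / A = v * (1 / A) - 1 := by field_simp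
    rw [e]
    ring
  have hint := MeasureTheory.integrableOn_Ioi_deriv_of_nonneg' (fun v _ => hd v) hpos hlim
  refine ⟨hint, ?_⟩
  rw [MeasureTheory.integral_Ioi_of_hasDerivAt_of_tendsto' (fun v _ => hd v) hint hlim]
  simp

/-- A sharp estimate for the tail of the prime zeta function to the right of `1`. -/
lemma exists_tsum_prime_tail_le :
    ∃ C : ℝ, 0 ≤ C ∧ ∀ X η : ℝ, 2 ≤ X → 0 < η →
      ∑' n : ℕ, (if n.Prime ∧ X < n then (n : ℝ) ^ (-(1 + η)) else 0) ≤
        Real.exp (-(η * Real.log X)) * (1 / (η * Real.log X) + C / Real.log X) := by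
  obtain ⟨C, hC0, hC⟩ := exists_abs_primeRecipSum_sub_le
  refine ⟨C, hC0, fun X η hX hη => ?_⟩
  have hlX : 0 < Real.log X := Real.log_pos (by linarith)
  set A := η * Real.log X with hA
  have hA0 : 0 < A := by positivity
  have hterm : ∀ n : ℕ, (if X < n then primeRecip n else 0) * Real.exp (-(η * Real.log n)) =
      if n.Prime ∧ X < n then (n : ℝ) ^ (-(1 + η)) else 0 := fun n => by
    rw [ite_mul, primeRecip_mul_exp, zero_mul]
    split_ifs <;> simp_all
  have hexp : ∀ {v : ℝ}, A ≤ v → X ≤ Real.exp (v / η) := fun {v} hv => by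
    rw [← Real.log_le_iff_le_exp (by linarith), le_div_iff₀ hη]
    linarith
  have hL := integrableOn_and_tsum_mul_exp_neg_eq
    (a := fun n => if X < n then primeRecip n else 0) (l := fun n => η * Real.log n)
    (A := fun v => max (primeRecipSum (Real.exp (v / η)) - primeRecipSum X) 0)
    (fun n => by split_ifs; exacts [primeRecip_nonneg n, le_rfl])
    (fun n => mul_nonneg hη.le (Real.log_natCast_nonneg n)) (by
      simp_rw [hterm]
      refine Summable.of_nonneg_of_le (fun n => ?_) (fun n => ?_)
        (summable_prime_rpow_neg (by linarith : 1 < 1 + η))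
      · split_ifs <;> positivity
      · by_cases h1 : n.Prime <;> by_cases h2 : X < n <;> simp [h1, h2]
        positivity) (by
      intro v hv
      rcases le_total A v with h | h
      · have hX' := hexp h
        rw [max_eq_left (sub_nonneg.2 (primeRecipSum_mono hX')), primeRecipSum_sub_eq hX']
        have e : ∑ k ∈ Ioc ⌊X⌋₊ ⌊Real.exp (v / η)⌋₊, primeRecip k =
            ∑ k ∈ Ioc ⌊X⌋₊ ⌊Real.exp (v / η)⌋₊,
              if η * Real.log k ≤ v then (if X < k then primeRecip k else 0) else 0 := by
          refine sum_congr rfl fun k hk => ?_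
          rw [mem_Ioc, Nat.floor_lt (by linarith), Nat.le_floor_iff (Real.exp_pos _).le] at hk
          have h2 := Real.log_le_log (by linarith [hk.1]) hk.2
          rw [Real.log_exp, le_div_iff₀ hη] at h2
          rw [if_pos (by linarith), if_pos hk.1]
        rw [e]
        apply hasSum_sum_of_ne_finset_zero
        intro k hk
        rw [mem_Ioc, Nat.floor_lt (by linarith), Nat.le_floor_iff (Real.exp_pos _).le,
          not_and] at hk
        by_cases h3 : X < k
        · have h4 := not_le.1 (hk h3)
          have h2 := Real.log_lt_log (Real.exp_pos _) h4
          rw [Real.log_exp, div_lt_iff₀ hη] at h2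
          rw [if_neg (by linarith)]
        · simp [h3]
      · have h1 : Real.exp (v / η) ≤ X := by
          rw [← Real.le_log_iff_exp_le (by linarith), div_le_iff₀ hη]
          linarith
        rw [max_eq_right (sub_nonpos.2 (primeRecipSum_mono h1))]
        convert hasSum_zero with k
        by_cases h3 : X < k
        · have h2 := Real.log_lt_log (by linarith) h3
          rw [if_neg]
          nlinarith
        · simp [h3])
  simp_rw [hterm] at hL
  rw [hL.2]
  obtain ⟨hgi, hg⟩ := integral_exp_neg_mul_linear A (C / Real.log X) hA0 (by positivity)
  rw [← hg]
  have hgi' : MeasureTheory.IntegrableOn ((Set.Ioi A).indicator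
      fun v : ℝ => Real.exp (-v) * ((v - A) / A + C / Real.log X)) (Set.Ioi 0) :=
    ((MeasureTheory.integrable_indicator_iff measurableSet_Ioi).2 hgi).integrableOn
  have e : ∫ v in Set.Ioi A, Real.exp (-v) * ((v - A) / A + C / Real.log X) =
      ∫ v in Set.Ioi 0, (Set.Ioi A).indicator
        (fun v : ℝ => Real.exp (-v) * ((v - A) / A + C / Real.log X)) v := by
    rw [MeasureTheory.setIntegral_indicator measurableSet_Ioi,
      Set.inter_eq_right.2 (Set.Ioi_subset_Ioi hA0.le)]
  rw [e]
  refine MeasureTheory.setIntegral_mono_on hL.1 hgi' measurableSet_Ioi fun v hv => ?_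
  have hv0 : 0 < v := hv
  by_cases h : v ∈ Set.Ioi A
  · rw [Set.indicator_of_mem h]
    have h' : A < v := h
    refine mul_le_mul_of_nonneg_left (max_le ?_ ?_) (Real.exp_pos _).le
    · have h1 := (abs_le.1 (hC X _ hX (hexp h'.le))).2
      rw [Real.log_exp, ← Real.log_div (by positivity) hlX.ne', div_div, ← hA] at h1
      have h2 := Real.log_le_sub_one_of_pos (div_pos hv0 hA0)
      have h3 : (v - A) / A = v / A - 1 := by field_simp
      linarith
    · have : 0 ≤ (v - A) / A := div_nonneg (by linarith) hA0.le
      positivity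
  · rw [Set.indicator_of_notMem h]
    have h1 : Real.exp (v / η) ≤ X := by
      rw [← Real.le_log_iff_exp_le (by linarith), div_le_iff₀ hη]
      have : v ≤ A := not_lt.1 h
      linarith
    rw [max_eq_right (sub_nonpos.2 (primeRecipSum_mono h1)), mul_zero]

lemma neg_log_one_add_inv_eq {p : ℕ} (hp : p.Prime) :
    -Real.log (1 + 1 / (p : ℝ)) = primeLogEuler 2 p - primeLogEuler 1 p := by
  have h2 : (2 : ℝ) ≤ p := by exact_mod_cast hp.two_le
  have h3 : 1 / (p : ℝ) ≤ 1 / 2 := by gcongr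
  have h4 : 0 < 1 / (p : ℝ) := by positivity
  simp only [primeLogEuler, if_pos hp]
  have e : 1 - (p : ℝ) ^ (-2 : ℝ) = (1 + 1 / (p : ℝ)) * (1 - (p : ℝ) ^ (-1 : ℝ)) := by
    rw [Real.rpow_neg_one, Real.rpow_neg (by positivity), Real.rpow_two]
    field_simp
    ring
  rw [e, Real.log_mul (by positivity)]
  · ring
  · rw [Real.rpow_neg_one, ← one_div]
    linarith

lemma tsum_primeLogEuler_two : ∑' n, primeLogEuler 2 n = Real.log (Real.pi ^ 2 / 6) := by
  have h := riemannZeta_eq_exp_tsum_primeLogEuler (s := 2) (by norm_num)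
  rw [show ((2 : ℝ) : ℂ) = 2 by norm_num, riemannZeta_two] at h
  have h2 : Real.pi ^ 2 / 6 = Real.exp (∑' n, primeLogEuler 2 n) := by exact_mod_cast h
  rw [h2, Real.log_exp]

open Filter Topology in
lemma tendsto_sum_neg_log_one_add_inv_add_log_log (q : ℕ) :
    Tendsto (fun x : ℝ => ∑ n ∈ Icc 0 ⌊x⌋₊ with n.Prime ∧ n ∉ q.primeFactors,
      -Real.log (1 + 1 / (n : ℝ)) + Real.log (Real.log x)) atTop
      (𝓝 (Real.log (Real.pi ^ 2 / 6 * Real.exp (-Real.eulerMascheroniConstant) *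
        ∏ p ∈ q.primeFactors, ((p : ℝ) + 1) / p))) := by
  have h2 : Tendsto (fun x : ℝ => ∑ n ∈ Icc 0 ⌊x⌋₊, primeLogEuler 2 n) atTop
      (𝓝 (∑' n, primeLogEuler 2 n)) := by
    have := ((summable_primeLogEuler one_lt_two).hasSum.tendsto_sum_nat.comp
      (tendsto_add_atTop_nat 1)).comp (tendsto_nat_floor_atTop (α := ℝ))
    refine this.congr fun x => ?_
    simp only [Function.comp, Nat.range_succ_eq_Icc_zero]
  have h3 := (h2.sub tendsto_sum_primeLogEuler_sub_log_log).add
    (tendsto_const_nhds (x := ∑ p ∈ q.primeFactors, Real.log (1 + 1 / (p : ℝ))))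
  have e : ∑' n, primeLogEuler 2 n - Real.eulerMascheroniConstant +
      ∑ p ∈ q.primeFactors, Real.log (1 + 1 / (p : ℝ)) =
      Real.log (Real.pi ^ 2 / 6 * Real.exp (-Real.eulerMascheroniConstant) *
        ∏ p ∈ q.primeFactors, ((p : ℝ) + 1) / p) := by
    have hne : ∀ p ∈ q.primeFactors, ((p : ℝ) + 1) / p ≠ 0 := fun p hp => by
      have := (Nat.prime_of_mem_primeFactors hp).pos
      positivity
    rw [Real.log_mul (by positivity) (prod_ne_zero_iff.2 hne),
      Real.log_mul (by positivity) (by positivity), Real.log_exp, tsum_primeLogEuler_two,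
      Real.log_prod hne, sub_eq_add_neg]
    congr 1
    refine sum_congr rfl fun p hp => ?_
    have : (p : ℝ) ≠ 0 := by
      exact_mod_cast (Nat.prime_of_mem_primeFactors hp).ne_zero
    congr 1
    field_simp
  rw [e] at h3
  refine h3.congr' ?_
  filter_upwards [eventually_ge_atTop (q : ℝ)] with x hx
  have hsub : q.primeFactors ⊆ (Icc 0 ⌊x⌋₊).filter Nat.Prime := by
    intro p hp
    have h1 := Nat.le_of_mem_primeFactors hp
    rw [mem_filter, mem_Icc]
    exact ⟨⟨zero_le, h1.trans (Nat.le_floor hx)⟩, Nat.prime_of_mem_primeFactors hp⟩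
  have h4 : ∑ n ∈ Icc 0 ⌊x⌋₊, primeLogEuler 2 n - ∑ n ∈ Icc 0 ⌊x⌋₊, primeLogEuler 1 n =
      ∑ n ∈ (Icc 0 ⌊x⌋₊).filter Nat.Prime, -Real.log (1 + 1 / (n : ℝ)) := by
    rw [← sum_sub_distrib, sum_filter]
    refine sum_congr rfl fun n _ => ?_
    split_ifs with hn
    · rw [neg_log_one_add_inv_eq hn]
    · simp [primeLogEuler, hn]
  have h5 : (Icc 0 ⌊x⌋₊).filter (fun n => n.Prime ∧ n ∉ q.primeFactors) =
      (Icc 0 ⌊x⌋₊).filter Nat.Prime \ q.primeFactors := by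
    ext n
    simp only [mem_filter, Finset.mem_sdiff]
    tauto
  have h6 := Finset.sum_sdiff hsub (f := fun n : ℕ => -Real.log (1 + 1 / (n : ℝ)))
  rw [h5]
  rw [sum_neg_distrib] at h6
  simp only [sum_neg_distrib] at h4 h6 ⊢
  linarith

section CharacterSums

variable {q : ℕ} {χ : DirichletCharacter ℂ q}

lemma DirichletCharacter.sum_range_eq_zero [NeZero q] (hχ : χ ≠ 1) :
    ∑ k ∈ range q, χ (k : ZMod q) = 0 := by
  rw [← MulChar.sum_eq_zero_of_ne_one hχ]
  refine sum_bij (fun k _ => (k : ZMod q)) (fun _ _ => mem_univ _) ?_ ?_ (fun _ _ => rfl)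
  · intro a ha b hb h
    rw [mem_range] at ha hb
    rw [ZMod.natCast_eq_natCast_iff'] at h
    rwa [Nat.mod_eq_of_lt ha, Nat.mod_eq_of_lt hb] at h
  · intro b _
    exact ⟨b.val, mem_range.2 b.val_lt, by simp⟩

lemma DirichletCharacter.norm_sum_range_le [NeZero q] (hχ : χ ≠ 1) (N : ℕ) :
    ‖∑ k ∈ range N, χ (k : ZMod q)‖ ≤ q := by
  induction N using Nat.strong_induction_on with
  | _ N ih =>
    rcases lt_or_ge N q with h | h
    · calc ‖∑ k ∈ range N, χ (k : ZMod q)‖ ≤ ∑ k ∈ range N, ‖χ (k : ZMod q)‖ := norm_sum_le _ _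
        _ ≤ ∑ k ∈ range N, 1 := sum_le_sum fun k _ => χ.norm_le_one _
        _ = N := by simp
        _ ≤ q := by exact_mod_cast h.le
    · obtain ⟨M, rfl⟩ := Nat.exists_eq_add_of_le h
      have hq := NeZero.pos q
      rw [sum_range_add, DirichletCharacter.sum_range_eq_zero hχ, zero_add]
      simpa using ih M (by omega)

/-- The partial sums of a Dirichlet character as a function of a real variable. -/
noncomputable def charSum (χ : DirichletCharacter ℂ q) (t : ℝ) : ℂ :=
  ∑ k ∈ Icc 1 ⌊t⌋₊, χ (k : ZMod q)

lemma norm_charSum_le [NeZero q] (hχ : χ ≠ 1) (t : ℝ) : ‖charSum χ t‖ ≤ q + 1 := by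
  have h : charSum χ t = ∑ k ∈ range (⌊t⌋₊ + 1), χ (k : ZMod q) - χ ((0 : ℕ) : ZMod q) := by
    rw [charSum, sum_range_succ']
    rw [range_eq_Ico, sum_Ico_add' (fun k : ℕ => χ (k : ZMod q)) 0 ⌊t⌋₊ 1]
    simp only [zero_add, add_sub_cancel_right]
    rfl
  rw [h]
  exact (norm_sub_le _ _).trans
    (add_le_add (DirichletCharacter.norm_sum_range_le hχ _) (χ.norm_le_one _))

lemma measurable_charSum : Measurable (charSum χ) :=
  (measurable_from_nat (f := fun n => ∑ k ∈ Icc 1 n, χ (k : ZMod q))).comp Nat.measurable_floor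

lemma charSum_eq_zero {t : ℝ} (ht : t < 1) : charSum χ t = 0 := by
  rw [charSum, Nat.floor_eq_zero.2 ht]
  simp

lemma differentiableAt_mellin_charSum [NeZero q] (hχ : χ ≠ 1) {s : ℂ} (hs : s.re < 0) :
    DifferentiableAt ℂ (mellin (charSum χ)) s := by
  apply mellin_differentiableAt_of_isBigO_rpow (a := 0) (b := s.re - 1) _ _ hs _ (by linarith)
  · apply MeasureTheory.LocallyIntegrable.locallyIntegrableOn
    intro x
    refine ⟨Set.Icc (x - 1) (x + 1), Icc_mem_nhds (by linarith) (by linarith), ?_⟩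
    refine MeasureTheory.Measure.integrableOn_of_bounded (M := q + 1) ?_ ?_ ?_
    · exact measure_Icc_lt_top.ne
    · exact measurable_charSum.aestronglyMeasurable
    · exact Filter.Eventually.of_forall fun t => norm_charSum_le hχ t
  · simp only [neg_zero, Real.rpow_zero]
    exact Asymptotics.isBigO_of_le' (c := q + 1) _ fun t => by simpa using norm_charSum_le hχ t
  · apply Asymptotics.IsBigO.of_bound 0
    have : Set.Iio (1 : ℝ) ∈ nhdsWithin (0 : ℝ) (Set.Ioi 0) :=
      mem_nhdsWithin_of_mem_nhds (Iio_mem_nhds one_pos)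
    filter_upwards [this] with t ht
    rw [charSum_eq_zero ht]
    simp

lemma mellin_charSum_eq (s : ℂ) :
    mellin (charSum χ) (-s) = ∫ t in Set.Ioi (1 : ℝ), charSum χ t * (t : ℂ) ^ (-(s + 1)) := by
  have h : mellin (charSum χ) (-s) = ∫ t in Set.Ioi (0 : ℝ),
      (Set.Ici (1 : ℝ)).indicator (fun t => charSum χ t * (t : ℂ) ^ (-(s + 1))) t := by
    rw [mellin]
    refine MeasureTheory.setIntegral_congr_fun measurableSet_Ioi fun t _ => ?_
    by_cases ht : t ∈ Set.Ici (1 : ℝ)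
    · rw [Set.indicator_of_mem ht]
      simp only [smul_eq_mul]
      rw [mul_comm, neg_add']
    · rw [Set.indicator_of_notMem ht]
      rw [charSum_eq_zero (not_le.1 ht), smul_zero]
  rw [h, MeasureTheory.setIntegral_indicator measurableSet_Ici,
    Set.inter_eq_right.2 (Set.Ici_subset_Ioi.2 one_pos), MeasureTheory.integral_Ici_eq_integral_Ioi]

lemma norm_mellin_charSum_le [NeZero q] (hχ : χ ≠ 1) {s : ℂ} (hs : 0 < s.re) :
    ‖mellin (charSum χ) (-s)‖ ≤ (q + 1) / s.re := by
  have hi : MeasureTheory.IntegrableOn (fun t : ℝ => (q + 1 : ℝ) * t ^ (-(s.re + 1)))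
      (Set.Ioi 1) := (integrableOn_Ioi_rpow_of_lt (by linarith) one_pos).const_mul _
  have hv : ∫ t in Set.Ioi (1 : ℝ), (q + 1 : ℝ) * t ^ (-(s.re + 1)) = (q + 1) / s.re := by
    rw [MeasureTheory.integral_const_mul, integral_Ioi_rpow_of_lt (by linarith) one_pos]
    simp
    field_simp
  rw [mellin_charSum_eq, ← hv]
  apply MeasureTheory.norm_integral_le_of_norm_le hi
  rw [MeasureTheory.ae_restrict_iff' measurableSet_Ioi]
  refine Filter.Eventually.of_forall fun t ht => ?_
  have ht' : (0 : ℝ) < t := lt_trans one_pos ht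
  rw [norm_mul, Complex.norm_cpow_eq_rpow_re_of_pos ht']
  simp only [neg_re, add_re, one_re]
  exact mul_le_mul_of_nonneg_right (norm_charSum_le hχ t) (by positivity)

lemma LFunction_eq_mul_mellin_charSum [NeZero q] (hχ : χ ≠ 1) {s : ℂ} (hs : 0 < s.re) :
    LFunction χ s = s * mellin (charSum χ) (-s) := by
  have hopen : IsOpen {s : ℂ | 0 < s.re} := isOpen_lt continuous_const continuous_re
  have hU : IsPreconnected {s : ℂ | 0 < s.re} := (convex_halfSpace_re_gt 0).isPreconnected
  have h1 : AnalyticOnNhd ℂ (LFunction χ) {s : ℂ | 0 < s.re} :=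
    (differentiable_LFunction hχ).differentiableOn.analyticOnNhd hopen
  have h2 : AnalyticOnNhd ℂ (fun s => s * mellin (charSum χ) (-s)) {s : ℂ | 0 < s.re} := by
    apply DifferentiableOn.analyticOnNhd _ hopen
    intro z hz
    have hz' : (-z).re < 0 := by simpa using hz
    have := (differentiableAt_mellin_charSum hχ hz').comp z (differentiableAt_id.neg)
    exact (differentiableAt_id.mul this).differentiableWithinAt
  refine h1.eqOn_of_preconnected_of_eventuallyEq h2 hU (z₀ := 2) (by simp) ?_ hs
  have h3 : {s : ℂ | 1 < s.re} ∈ nhds (2 : ℂ) :=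
    (isOpen_lt continuous_const continuous_re).mem_nhds (by simp)
  filter_upwards [h3] with z hz
  rw [LFunction_eq_LSeries χ hz, mellin_charSum_eq, LSeries_eq_mul_integral (r := 0) _ le_rfl
    (lt_trans one_pos hz) (LSeriesSummable_of_one_lt_re χ hz)]
  · rfl
  · simp only [Real.rpow_zero]
    refine Asymptotics.isBigO_of_le' (c := q + 1) _ fun n => ?_
    have := norm_charSum_le hχ (n : ℝ)
    simpa [charSum] using this

/-- A convexity-free polynomial bound for Dirichlet `L`-functions. -/
lemma norm_LFunction_le [NeZero q] (hχ : χ ≠ 1) {s : ℂ} (hs : 0 < s.re) :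
    ‖LFunction χ s‖ ≤ (q + 1) * ‖s‖ / s.re := by
  rw [LFunction_eq_mul_mellin_charSum hχ hs, norm_mul]
  calc ‖s‖ * ‖mellin (charSum χ) (-s)‖ ≤ ‖s‖ * ((q + 1) / s.re) := by
        gcongr
        exact norm_mellin_charSum_le hχ hs
    _ = _ := by ring

end CharacterSums

section LogEuler

variable {q : ℕ} {χ : DirichletCharacter ℂ q}

/-- The terms of the logarithm of the Euler product of `L(s, χ)`, indexed by natural numbers. -/
noncomputable def charLogEuler (χ : DirichletCharacter ℂ q) (s : ℂ) (n : ℕ) : ℂ :=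
  if n.Prime then -Complex.log (1 - χ n * (n : ℂ) ^ (-s)) else 0

lemma norm_char_mul_cpow_le {n : ℕ} (hn : n.Prime) (s : ℂ) :
    ‖χ n * (n : ℂ) ^ (-s)‖ ≤ (n : ℝ) ^ (-s.re) := by
  rw [norm_mul, Complex.norm_natCast_cpow_of_pos hn.pos]
  simpa using mul_le_mul_of_nonneg_right (χ.norm_le_one n) (by positivity)

lemma prime_rpow_neg_le_three_quarters {n : ℕ} (hn : n.Prime) {σ : ℝ} (hσ : 1 / 2 ≤ σ) :
    (n : ℝ) ^ (-σ) ≤ 3 / 4 := by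
  have hn2 : (2 : ℝ) ≤ n := by exact_mod_cast hn.two_le
  calc (n : ℝ) ^ (-σ) ≤ (n : ℝ) ^ (-(1 / 2) : ℝ) :=
        Real.rpow_le_rpow_of_exponent_le (by linarith) (by linarith)
    _ ≤ 2 ^ (-(1 / 2) : ℝ) :=
        Real.rpow_le_rpow_of_nonpos (by norm_num) hn2 (by norm_num)
    _ ≤ 3 / 4 := by
        rw [Real.rpow_neg (by norm_num), ← Real.sqrt_eq_rpow, inv_le_comm₀ (by positivity)
          (by norm_num)]
        exact Real.le_sqrt_of_sq_le (by norm_num)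

lemma norm_char_mul_cpow_le_three_quarters {n : ℕ} (hn : n.Prime) {s : ℂ} (hs : 1 / 2 ≤ s.re) :
    ‖χ n * (n : ℂ) ^ (-s)‖ ≤ 3 / 4 :=
  (norm_char_mul_cpow_le hn s).trans (prime_rpow_neg_le_three_quarters hn hs)

lemma norm_charLogEuler_le {s : ℂ} (hs : 1 / 2 ≤ s.re) (n : ℕ) :
    ‖charLogEuler χ s n‖ ≤ if n.Prime then 3 * (n : ℝ) ^ (-s.re) else 0 := by
  unfold charLogEuler
  split_ifs with hn
  · have h1 := norm_char_mul_cpow_le (χ := χ) hn s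
    have h2 := norm_char_mul_cpow_le_three_quarters (χ := χ) hn hs
    set z := χ n * (n : ℂ) ^ (-s)
    have h3 := Complex.norm_log_one_add_le (z := -z) (by rw [norm_neg]; linarith)
    rw [norm_neg] at h3
    rw [norm_neg, sub_eq_add_neg]
    have h4 : (1 - ‖z‖)⁻¹ ≤ 4 := by
      rw [inv_le_comm₀ (by linarith) (by norm_num)]
      linarith
    have h5 : ‖z‖ ^ 2 * (1 - ‖z‖)⁻¹ / 2 ≤ ‖z‖ ^ 2 * 4 / 2 := by gcongr
    nlinarith [norm_nonneg z]
  · simp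

lemma differentiableAt_charLogEuler {s : ℂ} (hs : 1 / 2 ≤ s.re) (n : ℕ) :
    DifferentiableAt ℂ (fun s => charLogEuler χ s n) s := by
  unfold charLogEuler
  by_cases hn : n.Prime
  · simp only [if_pos hn]
    have h2 := norm_char_mul_cpow_le_three_quarters (χ := χ) hn hs
    have h0 : (n : ℂ) ≠ 0 := by exact_mod_cast hn.ne_zero
    refine (DifferentiableAt.clog ?_ ?_).fun_neg
    · refine (((differentiableAt_id.fun_neg).const_cpow (Or.inl h0)).const_mul _).const_sub _
    · refine Or.inl ?_
      have := (Complex.re_le_norm (χ n * (n : ℂ) ^ (-s))).trans h2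
      rw [Complex.sub_re, Complex.one_re]
      exact sub_pos.2 (by linarith)
  · simp only [if_neg hn]
    exact differentiableAt_const _

lemma summable_prime_const_mul_rpow_neg {σ : ℝ} (hσ : 1 < σ) (c : ℝ) :
    Summable fun n : ℕ => if n.Prime then c * (n : ℝ) ^ (-σ) else 0 := by
  refine ((summable_prime_rpow_neg hσ).mul_left c).congr fun n => ?_
  rw [mul_ite, mul_zero]

lemma summable_norm_charLogEuler {s : ℂ} (hs : 1 < s.re) :
    Summable fun n => ‖charLogEuler χ s n‖ :=
  Summable.of_nonneg_of_le (fun _ => norm_nonneg _) (norm_charLogEuler_le (by linarith))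
    (summable_prime_const_mul_rpow_neg hs 3)

lemma exp_tsum_charLogEuler [NeZero q] {s : ℂ} (hs : 1 < s.re) :
    Complex.exp (∑' n, charLogEuler χ s n) = LFunction χ s := by
  rw [LFunction_eq_LSeries χ hs, ← DirichletCharacter.LSeries_eulerProduct_exp_log χ hs]
  congr 1
  have h : charLogEuler χ s =
      Set.indicator {p : ℕ | p.Prime} fun n : ℕ => -Complex.log (1 - χ n * (n : ℂ) ^ (-s)) := by
    ext n
    simp only [charLogEuler, Set.indicator, Set.mem_ofPred_eq]
  rw [h]
  exact (tsum_subtype {p : ℕ | p.Prime}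
    fun n : ℕ => -Complex.log (1 - χ n * (n : ℂ) ^ (-s))).symm

lemma differentiableAt_tsum_charLogEuler {s : ℂ} (hs : 1 < s.re) :
    DifferentiableAt ℂ (fun s => ∑' n, charLogEuler χ s n) s := by
  obtain ⟨r, hr1, hr2⟩ := exists_between hs
  have hU : IsOpen {w : ℂ | r < w.re} := isOpen_lt continuous_const continuous_re
  refine (differentiableOn_tsum_of_summable_norm (summable_prime_const_mul_rpow_neg hr1 3)
    (fun n w hw => (differentiableAt_charLogEuler ?_ n).differentiableWithinAt) hU
    (fun n w hw => (norm_charLogEuler_le ?_ n).trans ?_)).differentiableAt (hU.mem_nhds hr2)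
  · have : r < w.re := hw
    linarith
  · have : r < w.re := hw
    linarith
  · have : r < w.re := hw
    split_ifs with hn
    · have : (1 : ℝ) ≤ n := by exact_mod_cast hn.one_le
      gcongr
    · rfl

/-- If `L(s, χ)` does not vanish on the half-plane `σ₀ < re s`, then it has a holomorphic logarithm
there which extends the logarithm of the Euler product. -/
lemma exists_log_LFunction [NeZero q] (hχ : χ ≠ 1) {σ₀ : ℝ} (hσ₀ : σ₀ ≤ 1)
    (hne : ∀ s : ℂ, σ₀ < s.re → LFunction χ s ≠ 0) :
    ∃ l : ℂ → ℂ, (∀ s, σ₀ < s.re → DifferentiableAt ℂ l s) ∧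
      (∀ s, σ₀ < s.re → Complex.exp (l s) = LFunction χ s) ∧
      ∀ s, 1 < s.re → l s = ∑' n, charLogEuler χ s n := by
  have hL := differentiable_LFunction hχ
  have hopen (a : ℝ) : IsOpen {s : ℂ | a < s.re} := isOpen_lt continuous_const continuous_re
  have hpre (a : ℝ) : IsPreconnected {s : ℂ | a < s.re} :=
    (convex_halfSpace_re_gt a).isPreconnected
  obtain ⟨g, hg⟩ := (convex_halfSpace_re_gt σ₀).exists_forall_hasDerivWithinAt
    (f := fun s => deriv (LFunction χ) s / LFunction χ s) (fun s hs =>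
      ((hL.contDiff.differentiable_deriv_two.differentiableAt).div hL.differentiableAt
        (hne s hs)).differentiableWithinAt)
  have hg' : ∀ s, σ₀ < s.re → HasDerivAt g (deriv (LFunction χ) s / LFunction χ s) s :=
    fun s hs => (hg s hs).hasDerivAt ((hopen σ₀).mem_nhds hs)
  set G : ℂ → ℂ := fun s => ∑' n, charLogEuler χ s n
  have hG' : ∀ s, 1 < s.re → HasDerivAt G (deriv (LFunction χ) s / LFunction χ s) s := by
    intro s hs
    have h1 := (differentiableAt_tsum_charLogEuler (χ := χ) hs).hasDerivAt
    have h2 : (fun s => Complex.exp (G s)) =ᶠ[nhds s] LFunction χ := by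
      filter_upwards [(hopen 1).mem_nhds hs] with w hw using exp_tsum_charLogEuler hw
    have h3 := h2.deriv_eq
    rw [h1.cexp.deriv, exp_tsum_charLogEuler hs] at h3
    rw [← h3, mul_div_cancel_left₀ _ (hne s (by linarith))]
    exact h1
  have h2 : (2 : ℂ) ∈ {s : ℂ | 1 < s.re} := by simp
  set c : ℂ := G 2 - g 2
  have hgG : ∀ s, 1 < s.re → g s + c = G s := by
    intro s hs
    have := (hopen 1).is_const_of_deriv_eq_zero (hpre 1) (f := fun s => G s - g s)
      (fun w hw => ((hG' w hw).sub
        (hg' w (lt_of_le_of_lt hσ₀ hw))).differentiableAt.differentiableWithinAt)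
      (fun w hw => by
        have := ((hG' w hw).fun_sub (hg' w (lt_of_le_of_lt hσ₀ hw))).deriv
        rw [this, sub_self]
        rfl) hs h2
    have h : G s - g s = c := this
    rw [← h]
    ring
  refine ⟨fun s => g s + c, fun s hs => ((hg' s hs).add_const c).differentiableAt, ?_, hgG⟩
  intro s hs
  have hd : ∀ w, σ₀ < w.re →
      HasDerivAt (fun w => LFunction χ w * Complex.exp (-(g w + c))) 0 w := by
    intro w hw
    refine (hL.differentiableAt.hasDerivAt.fun_mul
      (((hg' w hw).add_const c).fun_neg.cexp)).congr_deriv ?_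
    have := hne w hw
    field_simp
    ring
  have hs2 := (hopen σ₀).is_const_of_deriv_eq_zero (hpre σ₀)
    (f := fun w => LFunction χ w * Complex.exp (-(g w + c)))
    (fun w hw => (hd w hw).differentiableAt.differentiableWithinAt)
    (fun w hw => (hd w hw).deriv) hs (y := 2) (lt_of_le_of_lt hσ₀ h2)
  rw [hgG 2 h2, ← exp_tsum_charLogEuler h2, ← Complex.exp_add, add_neg_cancel,
    Complex.exp_zero, Complex.exp_neg] at hs2
  field_simp at hs2
  exact hs2.symm

end LogEuler

section LogBounds

variable {q : ℕ} {χ : DirichletCharacter ℂ q}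

lemma norm_tsum_charLogEuler_le {s : ℂ} {σ : ℝ} (hσ : 1 < σ) (hs : σ ≤ s.re) :
    ‖∑' n, charLogEuler χ s n‖ ≤ ∑' n : ℕ, if n.Prime then 3 * (n : ℝ) ^ (-σ) else 0 := by
  refine tsum_of_norm_bounded (summable_prime_const_mul_rpow_neg hσ 3).hasSum fun n => ?_
  refine (norm_charLogEuler_le (by linarith) n).trans ?_
  split_ifs with hn
  · have : (1 : ℝ) ≤ n := by exact_mod_cast hn.one_le
    gcongr
  · rfl

lemma one_le_log_abs_add_four (t : ℝ) : 1 ≤ Real.log (|t| + 4) := by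
  rw [Real.le_log_iff_exp_le (by positivity)]
  linarith [Real.exp_one_lt_d9, abs_nonneg t]

/-- A logarithm of `L(s, χ)` grows at most logarithmically on closed strips inside its half-plane
of holomorphy. -/
lemma exists_norm_log_LFunction_le [NeZero q] (hχ : χ ≠ 1) {l : ℂ → ℂ}
    (hd : ∀ s : ℂ, 1 / 2 < s.re → DifferentiableAt ℂ l s)
    (hexp : ∀ s : ℂ, 1 / 2 < s.re → Complex.exp (l s) = LFunction χ s)
    (hsum : ∀ s : ℂ, 1 < s.re → l s = ∑' n, charLogEuler χ s n) {σ₀ : ℝ} (hσ₀ : 1 / 2 < σ₀) :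
    ∃ C : ℝ, 0 ≤ C ∧ ∀ w : ℂ, σ₀ ≤ w.re → w.re ≤ 2 →
      ‖l w‖ ≤ C * Real.log (|w.im| + 4) := by
  set M₀ : ℝ := ∑' n : ℕ, if n.Prime then 3 * (n : ℝ) ^ (-2 : ℝ) else 0
  have hM₀ : 0 ≤ M₀ := tsum_nonneg fun n => by split_ifs <;> positivity
  set K : ℝ := Real.log (4 * (q + 1))
  have hK : 0 ≤ K := Real.log_nonneg (by linarith [(Nat.cast_nonneg q : (0 : ℝ) ≤ q)])
  set d := σ₀ - 1 / 2
  have hd0 : 0 < d := sub_pos.2 hσ₀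
  refine ⟨(3 * (K + 1) + 3 * M₀) / d, by positivity, fun w hw1 hw2 => ?_⟩
  set t := w.im
  set v := Real.log (|t| + 4)
  have hv : 1 ≤ v := one_le_log_abs_add_four t
  set c : ℂ := ⟨2, t⟩
  have hre : ∀ z ∈ Metric.ball (0 : ℂ) (3 / 2), 1 / 2 < (c + z).re := by
    intro z hz
    have h1 := (abs_le.1 ((Complex.abs_re_le_norm z))).1
    have h2 : ‖z‖ < 3 / 2 := by simpa using hz
    simp only [Complex.add_re, c]
    linarith
  have hmaps : Set.MapsTo (fun z => l (c + z)) (Metric.ball 0 (3 / 2)) {z | z.re ≤ K + v} := by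
    intro z hz
    have hz' := hre z hz
    have hz2 : ‖z‖ < 3 / 2 := by simpa using hz
    have hn := hexp _ hz'
    have h1 : Real.exp (l (c + z)).re = ‖LFunction χ (c + z)‖ := by
      rw [← hn, Complex.norm_exp]
    have h2 := norm_LFunction_le hχ (s := c + z) (by linarith)
    have h3 : ‖c + z‖ ≤ |t| + 4 := by
      have hc : ‖c‖ ≤ 2 + |t| := by
        simpa [c] using Complex.norm_le_abs_re_add_abs_im c
      linarith [norm_add_le c z]
    show (l (c + z)).re ≤ K + v
    rw [← Real.exp_le_exp, h1, Real.exp_add, Real.exp_log (by positivity),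
      Real.exp_log (by positivity)]
    refine h2.trans ?_
    rw [div_le_iff₀ (by linarith)]
    have h4 : ((q : ℝ) + 1) * ‖c + z‖ ≤ (q + 1) * (|t| + 4) := by gcongr
    have h5 : (0 : ℝ) ≤ (q + 1) * (|t| + 4) := by positivity
    nlinarith
  have hz : w - c ∈ Metric.ball (0 : ℂ) (3 / 2) ∧ ‖w - c‖ ≤ 3 / 2 - d := by
    have h : w - c = ((w.re - 2 : ℝ) : ℂ) := by
      apply Complex.ext <;> simp [c, t]
    have h2 : ‖w - c‖ = 2 - w.re := by
      rw [h, Complex.norm_real, Real.norm_eq_abs, abs_of_nonpos (by linarith)]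
      ring
    rw [mem_ball_zero_iff, h2]
    have : d = σ₀ - 1 / 2 := rfl
    constructor <;> linarith
  have hBC := Complex.borelCaratheodory (M := K + v) (R := 3 / 2) (by linarith)
    (fun z hz => by
      have h1 : DifferentiableAt ℂ (fun z => c + z) z := by fun_prop
      exact ((hd _ (hre z hz)).comp z h1).differentiableWithinAt)
    hmaps (by norm_num) hz.1
  simp only [add_sub_cancel, add_zero] at hBC
  have hc : ‖l c‖ ≤ M₀ := by
    rw [hsum c (by simp [c])]
    exact norm_tsum_charLogEuler_le one_lt_two (by simp [c])
  have hr : d ≤ 3 / 2 - ‖w - c‖ := by linarith [hz.2]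
  have hw0 := norm_nonneg (w - c)
  have b1 : 2 * (K + v) * ‖w - c‖ / (3 / 2 - ‖w - c‖) ≤ 3 * (K + v) / d := by
    have : 2 * (K + v) * ‖w - c‖ ≤ 3 * (K + v) := by nlinarith
    gcongr
  have b2 : ‖l c‖ * (3 / 2 + ‖w - c‖) / (3 / 2 - ‖w - c‖) ≤ 3 * M₀ / d := by
    have : ‖l c‖ * (3 / 2 + ‖w - c‖) ≤ M₀ * 3 := by
      gcongr
      linarith
    rw [mul_comm 3]
    gcongr
  calc ‖l w‖ ≤ 3 * (K + v) / d + 3 * M₀ / d := hBC.trans (add_le_add b1 b2)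
    _ = (3 * (K + v) + 3 * M₀) / d := by ring
    _ ≤ ((3 * (K + 1) + 3 * M₀) * v) / d := by
        gcongr
        nlinarith
    _ = _ := by ring

lemma sum_Icc_rpow_le {a : ℝ} (ha0 : 0 < a) (ha1 : a ≤ 1) (N : ℕ) :
    ∑ n ∈ Icc 1 N, (n : ℝ) ^ (a - 1) ≤ (N : ℝ) ^ a / a := by
  induction N with
  | zero => simp [Real.zero_rpow ha0.ne']
  | succ N ih =>
    rw [sum_Icc_succ_top (by omega)]
    have hN : (0 : ℝ) < (N + 1 : ℕ) := by positivity
    have hB := rpow_one_add_le_one_add_mul_self (s := -1 / (N + 1 : ℕ)) (p := a)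
      (by rw [le_div_iff₀ hN]; push_cast; linarith [(Nat.cast_nonneg N : (0 : ℝ) ≤ N)])
      ha0.le ha1
    have e : (1 : ℝ) + -1 / (N + 1 : ℕ) = N / (N + 1 : ℕ) := by
      field_simp
      push_cast
      ring
    rw [e, Real.div_rpow (Nat.cast_nonneg N) hN.le, div_le_iff₀ (by positivity)] at hB
    rw [Real.rpow_sub_one hN.ne']
    rw [le_div_iff₀ ha0] at ih ⊢
    refine le_trans ?_ (le_of_eq (by ring : (N + 1 : ℕ) ^ a - a * ((N + 1 : ℕ) ^ a / (N + 1 : ℕ)) +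
      a * ((N + 1 : ℕ) ^ a / (N + 1 : ℕ)) = ((N + 1 : ℕ) : ℝ) ^ a))
    have e2 : (1 + a * (-1 / ((N + 1 : ℕ) : ℝ))) * ((N + 1 : ℕ) : ℝ) ^ a =
      ((N + 1 : ℕ) : ℝ) ^ a - a * (((N + 1 : ℕ) : ℝ) ^ a / ((N + 1 : ℕ) : ℝ)) := by ring
    rw [e2] at hB
    linarith

/-- A trivial bound for the truncated logarithm of the Euler product. -/
lemma norm_sum_charLogEuler_le {a : ℝ} (ha0 : 0 < a) (ha1 : a ≤ 1 / 2) {X : ℝ} (hX : 0 ≤ X)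
    {w : ℂ} (hw : 1 - a ≤ w.re) :
    ‖∑ n ∈ Icc 0 ⌊X⌋₊, charLogEuler χ w n‖ ≤ 3 / a * X ^ a := by
  have h0 : charLogEuler χ w 0 = 0 := by simp [charLogEuler, Nat.not_prime_zero]
  have h : ∑ n ∈ Icc 0 ⌊X⌋₊, charLogEuler χ w n = ∑ n ∈ Icc 1 ⌊X⌋₊, charLogEuler χ w n := by
    refine (sum_subset (Icc_subset_Icc_left zero_le_one) fun n hn hn' => ?_).symm
    rw [mem_Icc] at hn hn'
    rw [show n = 0 by omega, h0]
  rw [h]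
  calc ‖∑ n ∈ Icc 1 ⌊X⌋₊, charLogEuler χ w n‖
      ≤ ∑ n ∈ Icc 1 ⌊X⌋₊, 3 * (n : ℝ) ^ (a - 1) := by
        refine norm_sum_le_of_le _ fun n hn => ?_
        refine (norm_charLogEuler_le (by linarith) n).trans ?_
        have h1 : (1 : ℝ) ≤ n := by exact_mod_cast (mem_Icc.1 hn).1
        split_ifs
        · gcongr
          linarith
        · positivity
    _ ≤ 3 * (X ^ a / a) := by
        rw [← mul_sum]
        gcongr
        refine (sum_Icc_rpow_le ha0 (by linarith) _).trans ?_
        gcongr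
        exact Nat.floor_le hX
    _ = _ := by ring

/-- Absolute bound for the tail of the Euler product. -/
lemma norm_tsum_sub_sum_charLogEuler_le {X σ : ℝ} (hσ : 1 < σ) (hX : 0 ≤ X) {s : ℂ}
    (hs : σ ≤ s.re) :
    ‖∑' n, charLogEuler χ s n - ∑ n ∈ Icc 0 ⌊X⌋₊, charLogEuler χ s n‖ ≤
      3 * ∑' n : ℕ, if n.Prime ∧ X < n then (n : ℝ) ^ (-σ) else 0 := by
  have hsum := (summable_norm_charLogEuler (χ := χ) (s := s) (by linarith)).of_norm
  have hsum2 : Summable fun n : ℕ => if n.Prime ∧ X < n then (n : ℝ) ^ (-σ) else 0 := by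
    refine Summable.of_nonneg_of_le (fun n => ?_) (fun n => ?_) (summable_prime_rpow_neg hσ)
    · split_ifs <;> positivity
    · by_cases h1 : n.Prime <;> by_cases h2 : X < n <;> simp [h1, h2]
      positivity
  have h1 : ∑' n, charLogEuler χ s n - ∑ n ∈ Icc 0 ⌊X⌋₊, charLogEuler χ s n =
      ∑' n : ℕ, if X < n then charLogEuler χ s n else 0 := by
    have hfin : ∑ n ∈ Icc 0 ⌊X⌋₊, charLogEuler χ s n =
        ∑' n : ℕ, if n ∈ Icc 0 ⌊X⌋₊ then charLogEuler χ s n else 0 := by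
      rw [tsum_eq_sum (s := Icc 0 ⌊X⌋₊) (fun n hn => if_neg hn)]
      exact sum_congr rfl fun n hn => (if_pos hn).symm
    rw [hfin, ← hsum.tsum_sub]
    · refine tsum_congr fun n => ?_
      have hmem : n ∈ Icc 0 ⌊X⌋₊ ↔ ¬ X < n := by
        rw [mem_Icc, Nat.le_floor_iff hX, not_lt]
        simp
      by_cases hn : X < n <;> simp [hmem, hn]
    · exact summable_of_ne_finset_zero (s := Icc 0 ⌊X⌋₊) fun n hn => if_neg hn
  rw [h1]
  refine tsum_of_norm_bounded (hsum2.hasSum.mul_left 3) fun n => ?_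
  by_cases h2 : X < n
  · rw [if_pos h2]
    refine (norm_charLogEuler_le (by linarith) n).trans ?_
    by_cases hn : n.Prime
    · have : (1 : ℝ) ≤ n := by exact_mod_cast hn.one_le
      simp only [hn, h2, and_self, if_true]
      gcongr
    · simp [hn]
  · simp [h2]

end LogBounds

lemma log_abs_add_four_le (x y : ℝ) :
    Real.log (|x + y| + 4) ≤ Real.log (|x| + 4) + |y| := by
  have h1 : |x + y| + 4 ≤ (|x| + 4) * Real.exp |y| := by
    have h2 := Real.add_one_le_exp |y|
    have h3 : (|x| + 4) * (|y| + 1) ≤ (|x| + 4) * Real.exp |y| := by gcongr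
    nlinarith [abs_add_le x y, abs_nonneg x, abs_nonneg y]
  calc Real.log (|x + y| + 4) ≤ Real.log ((|x| + 4) * Real.exp |y|) :=
        Real.log_le_log (by positivity) h1
    _ = _ := by rw [Real.log_mul (by positivity) (Real.exp_pos _).ne', Real.log_exp]

lemma norm_cexp_sub_sq {w s : ℂ} :
    ‖Complex.exp ((w - s) ^ 2)‖ = Real.exp ((w.re - s.re) ^ 2) * Real.exp (-(w.im - s.im) ^ 2) := by
  rw [Complex.norm_exp, ← Real.exp_add]
  congr 1
  rw [sq, Complex.mul_re, Complex.sub_re, Complex.sub_im]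
  ring

/-- A version of the Hadamard three lines theorem for functions growing at most logarithmically. -/
lemma norm_le_interp_of_norm_le_log {E : ℂ → ℂ} {lo hi : ℝ} (hlt : lo < hi) (hwid : hi - lo ≤ 1)
    (hd : ∀ w : ℂ, lo ≤ w.re → w.re ≤ hi → DifferentiableAt ℂ E w) {P Q b : ℝ} (hP : 0 ≤ P)
    (hQ : 0 ≤ Q) (hE : ∀ w : ℂ, lo ≤ w.re → w.re ≤ hi → ‖E w‖ ≤ P * Real.log (|w.im| + 4) + Q)
    (hb : ∀ w : ℂ, w.re = hi → ‖E w‖ ≤ b) {s : ℂ} (hs1 : lo ≤ s.re) (hs2 : s.re ≤ hi) :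
    ‖E s‖ ≤ (Real.exp 1 * (P * (Real.log (|s.im| + 4) + 1) + Q)) ^
        (1 - (s.re - lo) / (hi - lo)) * (Real.exp 1 * b) ^ ((s.re - lo) / (hi - lo)) := by
  set F : ℂ → ℂ := fun w => E w * Complex.exp ((w - s) ^ 2) with hF
  have hexp : ∀ w : ℂ, lo ≤ w.re → w.re ≤ hi →
      ‖Complex.exp ((w - s) ^ 2)‖ ≤ Real.exp 1 * Real.exp (-(w.im - s.im) ^ 2) := by
    intro w h1 h2
    rw [norm_cexp_sub_sq]
    gcongr
    rw [sq_le_one_iff_abs_le_one, abs_le]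
    constructor <;> linarith
  have hFd : ∀ w : ℂ, lo ≤ w.re → w.re ≤ hi → DifferentiableAt ℂ F w := fun w h1 h2 =>
    (hd w h1 h2).fun_mul (by fun_prop)
  have hFa : ∀ w : ℂ, lo ≤ w.re → w.re ≤ hi →
      ‖F w‖ ≤ Real.exp 1 * (P * (Real.log (|s.im| + 4) + 1) + Q) := by
    intro w h1 h2
    set y := w.im - s.im
    have h3 := log_abs_add_four_le s.im y
    rw [show s.im + y = w.im by simp [y]] at h3
    have h4 := one_le_log_abs_add_four s.im
    have h5 : Real.exp (-y ^ 2) ≤ 1 := Real.exp_le_one_iff.2 (by nlinarith [sq_nonneg y])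
    have h6 : |y| * Real.exp (-y ^ 2) ≤ 1 := by
      rw [Real.exp_neg, ← div_eq_mul_inv, div_le_one (Real.exp_pos _)]
      have := Real.add_one_le_exp (y ^ 2)
      nlinarith [sq_abs y, sq_nonneg (|y| - 1), sq_nonneg (|y|)]
    have h0 := Real.exp_pos (-y ^ 2)
    have h7 : ‖E w‖ * Real.exp (-y ^ 2) ≤ P * (Real.log (|s.im| + 4) + 1) + Q := by
      calc ‖E w‖ * Real.exp (-y ^ 2)
          ≤ (P * (Real.log (|s.im| + 4) + |y|) + Q) * Real.exp (-y ^ 2) := by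
            gcongr
            exact (hE w h1 h2).trans (by gcongr)
        _ = P * (Real.log (|s.im| + 4) * Real.exp (-y ^ 2) + |y| * Real.exp (-y ^ 2)) +
            Q * Real.exp (-y ^ 2) := by ring
        _ ≤ P * (Real.log (|s.im| + 4) * 1 + 1) + Q * 1 := by gcongr
        _ = _ := by ring
    calc ‖F w‖ = ‖E w‖ * ‖Complex.exp ((w - s) ^ 2)‖ := norm_mul _ _
      _ ≤ ‖E w‖ * (Real.exp 1 * Real.exp (-y ^ 2)) := by
          gcongr
          exact hexp w h1 h2
      _ = Real.exp 1 * (‖E w‖ * Real.exp (-y ^ 2)) := by ring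
      _ ≤ _ := by gcongr
  have key := Complex.HadamardThreeLines.norm_le_interp_of_mem_verticalClosedStrip' (f := F)
    (z := s) (a := Real.exp 1 * (P * (Real.log (|s.im| + 4) + 1) + Q)) (b := Real.exp 1 * b)
    hlt ⟨hs1, hs2⟩ ?_ ?_ ?_ ?_
  · simpa [hF] using key
  · apply DifferentiableOn.diffContOnCl
    intro w hw
    have hcl : w ∈ Complex.re ⁻¹' Set.Icc lo hi := by
      rw [← closure_Ioo hlt.ne, ← Complex.closure_preimage_re]
      exact hw
    exact (hFd w hcl.1 hcl.2).differentiableWithinAt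
  · refine ⟨Real.exp 1 * (P * (Real.log (|s.im| + 4) + 1) + Q), ?_⟩
    rintro _ ⟨w, hw, rfl⟩
    exact hFa w hw.1 hw.2
  · intro w hw
    have hw' : w.re = lo := hw
    exact hFa w hw'.ge (hw'.le.trans hlt.le)
  · intro w hw
    have hw' : w.re = hi := hw
    have h1 := hexp w (hlt.le.trans hw'.ge) hw'.le
    have h2 : Real.exp (-(w.im - s.im) ^ 2) ≤ 1 :=
      Real.exp_le_one_iff.2 (by nlinarith [sq_nonneg (w.im - s.im)])
    have h3 : ‖Complex.exp ((w - s) ^ 2)‖ ≤ Real.exp 1 :=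
      h1.trans (mul_le_of_le_one_right (Real.exp_pos _).le h2)
    calc ‖F w‖ = ‖E w‖ * ‖Complex.exp ((w - s) ^ 2)‖ := norm_mul _ _
      _ ≤ b * Real.exp 1 := mul_le_mul (hb w hw') h3 (norm_nonneg _)
          ((norm_nonneg _).trans (hb w hw'))
      _ = _ := mul_comm _ _

lemma interp_bound_le {A K y θ : ℝ} (hA : 1 ≤ A) (hK : 1 ≤ K) (hy : 0 < y) (hθ0 : 0 ≤ θ)
    (hθ : θ ≤ A / y) (h1 : A * Real.log K ≤ y) (h2 : 2 * A ^ 2 ≤ y) :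
    (K * Real.exp y) ^ θ * (Real.exp 1 * (6 * Real.exp (-A) / A)) ^ (1 - θ) ≤
      6 * Real.exp 3 / A := by
  have hK' := Real.log_nonneg hK
  have b1 : (K * Real.exp y) ^ θ ≤ Real.exp (1 + A) := by
    rw [Real.rpow_def_of_pos (by positivity), Real.log_mul (by positivity) (by positivity),
      Real.log_exp]
    gcongr
    calc (Real.log K + y) * θ ≤ (Real.log K + y) * (A / y) := by gcongr
      _ = A * Real.log K / y + A := by field_simp
      _ ≤ 1 + A := by
        gcongr
        exact (div_le_one hy).2 h1
  set B := Real.exp 1 * (6 * Real.exp (-A) / A) with hB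
  have hB0 : 0 < B := by positivity
  have b2 : B ^ (1 - θ) ≤ B * Real.exp 1 := by
    rw [sub_eq_add_neg, Real.rpow_add hB0, Real.rpow_one]
    gcongr
    rw [Real.rpow_def_of_pos hB0]
    gcongr
    have h3 : -Real.log B ≤ 2 * A := by
      have : Real.log B = 1 + (Real.log 6 + -A - Real.log A) := by
        rw [hB, Real.log_mul (by positivity) (by positivity), Real.log_exp,
          Real.log_div (by positivity) (by positivity), Real.log_mul (by positivity)
          (by positivity), Real.log_exp]
      have h4 : 0 ≤ Real.log 6 := Real.log_nonneg (by norm_num)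
      have h5 := Real.log_le_sub_one_of_pos (show 0 < A by linarith)
      linarith
    calc Real.log B * -θ = -Real.log B * θ := by ring
      _ ≤ 2 * A * (A / y) := by gcongr
      _ = 2 * A ^ 2 / y := by ring
      _ ≤ 1 := (div_le_one hy).2 h2
  calc (K * Real.exp y) ^ θ * B ^ (1 - θ) ≤ Real.exp (1 + A) * (B * Real.exp 1) := by gcongr
    _ = (Real.exp (1 + A) * Real.exp 1 * Real.exp (-A) * Real.exp 1) * (6 / A) := by
        rw [hB]; ring
    _ = _ := by
        rw [← Real.exp_add, ← Real.exp_add, ← Real.exp_add,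
          show 1 + A + 1 + -A + 1 = 3 by ring]
        ring

open Filter in
/-- Approximation of `log L(s, χ)` by a short sum over primes in the half-plane `1 ≤ re s`. -/
lemma eventually_norm_log_sub_sum_charLogEuler_le {q : ℕ} [NeZero q] {χ : DirichletCharacter ℂ q}
    (hχ : χ ≠ 1) {l : ℂ → ℂ} (hd : ∀ s : ℂ, 1 / 2 < s.re → DifferentiableAt ℂ l s)
    (hexp : ∀ s : ℂ, 1 / 2 < s.re → Complex.exp (l s) = LFunction χ s)
    (hsum : ∀ s : ℂ, 1 < s.re → l s = ∑' n, charLogEuler χ s n) {a : ℝ} (ha0 : 0 < a)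
    (ha : a < 1 / 2) {A : ℝ} (hA : 1 ≤ A) :
    ∀ᶠ τ : ℝ in atTop, ∀ s : ℂ, s.im = τ → 1 ≤ s.re →
      ‖l s - ∑ n ∈ Icc 0 ⌊(Real.log τ) ^ (1 / a)⌋₊, charLogEuler χ s n‖ ≤
        6 * Real.exp 3 / A := by
  obtain ⟨C, hC0, hC⟩ := exists_norm_log_LFunction_le hχ hd hexp hsum
    (σ₀ := 1 - a) (by linarith)
  obtain ⟨C₁, hC₁0, hC₁⟩ := exists_tsum_prime_tail_le
  set K : ℝ := Real.exp 1 * (3 * C + 3 / a) with hK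
  have hK1 : 1 ≤ K := by
    have h1 : 1 ≤ Real.exp 1 := Real.one_le_exp zero_le_one
    have h2 : 1 ≤ 3 / a := by
      rw [le_div_iff₀ ha0]
      linarith
    exact one_le_mul_of_one_le_of_one_le h1 (by linarith)
  have hll : Tendsto (fun τ : ℝ => Real.log (Real.log τ)) atTop atTop :=
    Real.tendsto_log_atTop.comp Real.tendsto_log_atTop
  filter_upwards [eventually_ge_atTop 4, hll.eventually_ge_atTop 1,
    hll.eventually_ge_atTop (2 * A ^ 2), hll.eventually_ge_atTop (C₁ * a * A),
    hll.eventually_ge_atTop (A * Real.log K)] with τ hτ4 hy1 hyA hyC hyK s hsτ hs1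
  set y := Real.log (Real.log τ) with hy
  have hL : 1 < Real.log τ := by
    rw [Real.lt_log_iff_exp_lt (by linarith)]
    linarith [Real.exp_one_lt_d9]
  have hLy : Real.exp y = Real.log τ := Real.exp_log (by linarith)
  set X := (Real.log τ) ^ (1 / a) with hX
  have hX0 : 0 < X := by positivity
  have hXa : X ^ a = Real.log τ := by
    rw [hX, ← Real.rpow_mul (by linarith), one_div_mul_cancel ha0.ne', Real.rpow_one]
  have hlX : Real.log X = y / a := by
    rw [hX, Real.log_rpow (by linarith)]
    ring
  have hya : 1 ≤ y / a := by
    rw [le_div_iff₀ ha0]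
    linarith
  have hX2 : 2 ≤ X := by
    have h1 := Real.add_one_le_exp (Real.log X)
    rw [Real.exp_log hX0] at h1
    linarith
  have hA0 : 0 < A := by linarith
  have hy0 : 0 < y := by linarith
  set η := A * a / y with hη
  have hη0 : 0 < η := by positivity
  have hη1 : η ≤ 1 / 2 := by
    rw [hη, div_le_iff₀ hy0]
    nlinarith
  have hηX : η * Real.log X = A := by
    rw [hη, hlX]
    field_simp
  have htail : 3 * ∑' n : ℕ, (if n.Prime ∧ X < n then (n : ℝ) ^ (-(1 + η)) else 0) ≤
      6 * Real.exp (-A) / A := by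
    have h1 := hC₁ X η hX2 hη0
    rw [hηX, hlX] at h1
    have h2 : C₁ / (y / a) ≤ 1 / A := by
      rw [div_le_div_iff₀ (by positivity) hA0, one_mul, le_div_iff₀ ha0]
      linarith
    calc _ ≤ 3 * (Real.exp (-A) * (1 / A + 1 / A)) := by
          gcongr
          exact h1.trans (by gcongr)
      _ = _ := by ring
  have hright : ∀ w : ℂ, 1 + η ≤ w.re →
      ‖l w - ∑ n ∈ Icc 0 ⌊X⌋₊, charLogEuler χ w n‖ ≤ 6 * Real.exp (-A) / A := fun w hw => by
    rw [hsum w (by linarith)]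
    exact (norm_tsum_sub_sum_charLogEuler_le (by linarith) hX0.le hw).trans htail
  rcases le_total (1 + η) s.re with hs2 | hs2
  · refine (hright s hs2).trans ?_
    gcongr
    linarith
  have key := norm_le_interp_of_norm_le_log
    (E := fun w => l w - ∑ n ∈ Icc 0 ⌊X⌋₊, charLogEuler χ w n) (lo := 1 - a) (hi := 1 + η)
    (P := C) (Q := 3 / a * Real.log τ) (by linarith) (by linarith) ?_ hC0 (by positivity) ?_
    (fun w hw => hright w hw.ge) (s := s) (by linarith) hs2
  · refine key.trans ?_
    set t := (s.re - (1 - a)) / (1 + η - (1 - a)) with ht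
    have hθ : 1 - t = (1 + η - s.re) / (a + η) := by
      have h0 : a + η ≠ 0 := by positivity
      rw [ht, show 1 + η - (1 - a) = a + η by ring, eq_div_iff h0, sub_mul, div_mul_cancel₀ _ h0]
      ring
    have hθ0 : 0 ≤ 1 - t := by
      rw [hθ]
      exact div_nonneg (by linarith) (by linarith)
    have hθ1 : 1 - t ≤ A / y := by
      rw [hθ]
      calc (1 + η - s.re) / (a + η) ≤ η / a := by
            gcongr <;> linarith
        _ = A / y := by
            rw [hη]
            field_simp
    have hlog : Real.log (|s.im| + 4) ≤ 2 * Real.log τ := by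
      rw [hsτ, abs_of_nonneg (by linarith), two_mul, ← Real.log_mul (by linarith) (by linarith)]
      exact Real.log_le_log (by linarith) (by nlinarith)
    have hb := interp_bound_le hA hK1 hy0 hθ0 hθ1 hyK hyA
    rw [sub_sub_cancel] at hb
    have hl0 := one_le_log_abs_add_four s.im
    have hbase : Real.exp 1 * (C * (Real.log (|s.im| + 4) + 1) + 3 / a * Real.log τ) ≤
        K * Real.exp y := by
      rw [hLy, hK, mul_assoc]
      gcongr
      nlinarith
    refine le_trans ?_ hb
    gcongr
  · intro w h1 h2
    refine (hd w (by linarith)).fun_sub (DifferentiableAt.fun_sum fun n _ => ?_)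
    exact differentiableAt_charLogEuler (by linarith) n
  · intro w h1 h2
    have h3 := norm_sum_charLogEuler_le (χ := χ) ha0 ha.le hX0.le h1
    rw [hXa] at h3
    exact (norm_sub_le _ _).trans (add_le_add (hC w h1 (by linarith)) h3)

/-- Lower bound for the truncated Euler product on the half-plane `1 ≤ re s`. -/
lemma sum_neg_log_one_add_inv_le_re {q : ℕ} (χ : DirichletCharacter ℂ q) {s : ℂ}
    (hs : 1 ≤ s.re) (N : ℕ) :
    ∑ n ∈ Icc 0 N with n.Prime ∧ n ∉ q.primeFactors, -Real.log (1 + 1 / (n : ℝ)) ≤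
      (∑ n ∈ Icc 0 N, charLogEuler χ s n).re := by
  rw [Complex.re_sum, sum_filter]
  refine sum_le_sum fun n _ => ?_
  unfold charLogEuler
  by_cases hn : n.Prime
  · by_cases hnq : n ∈ q.primeFactors
    · have hχ : χ n = 0 := by
        refine χ.map_nonunit fun h => ?_
        rw [ZMod.isUnit_iff_coprime, hn.coprime_iff_not_dvd] at h
        exact h (Nat.dvd_of_mem_primeFactors hnq)
      simp [hn, hnq, hχ]
    · have h1 : (1 : ℝ) ≤ n := by exact_mod_cast hn.one_le
      have h2 : ‖χ n * (n : ℂ) ^ (-s)‖ ≤ 1 / n := by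
        refine (norm_char_mul_cpow_le hn s).trans ?_
        rw [one_div, ← Real.rpow_neg_one]
        gcongr
      have h3 := norm_char_mul_cpow_le_three_quarters (χ := χ) hn (s := s) (by linarith)
      have h4 := norm_sub_norm_le 1 (χ n * (n : ℂ) ^ (-s))
      have h5 := norm_sub_le 1 (χ n * (n : ℂ) ^ (-s))
      rw [norm_one] at h4 h5
      rw [if_pos ⟨hn, hnq⟩, if_pos hn, Complex.neg_re, Complex.log_re]
      exact neg_le_neg (Real.log_le_log (by linarith) (by linarith))
  · simp [hn]

/-- **Theorem 3.** Assume GRH for `χ`. Then at critical points `ρ'` of the Riemann zeta function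
with `Re ρ' ≥ 1` and `Im ρ' → ∞`,
`liminf |L(ρ',χ)| log log (Im ρ') ≥ (π² e^{−C₀}/12) ∏_{p ∣ q} (p+1)/p`. -/
theorem small_values_lower_bound (q : ℕ) [NeZero q] (hq : 2 < q)
    (χ : DirichletCharacter ℂ q) (hχ : χ.IsPrimitive)
    (hGRH : ∀ s : ℂ, LFunction χ s = 0 → 0 < s.re → s.re < 1 → s.re = 1 / 2) :
    ∀ ε : ℝ, 0 < ε → ∃ T₀ : ℝ, 4 ≤ T₀ ∧
      ∀ ρ' : ℂ, deriv riemannZeta ρ' = 0 → 1 ≤ ρ'.re → T₀ ≤ ρ'.im →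
        (Real.pi ^ 2 * Real.exp (-Real.eulerMascheroniConstant) / 12) *
            (∏ p ∈ q.primeFactors, ((p : ℝ) + 1) / p) - ε ≤
          ‖LFunction χ ρ'‖ * Real.log (Real.log ρ'.im) := by
  intro ε hε
  have hχ1 : χ ≠ 1 := by
    rintro rfl
    have h : DirichletCharacter.conductor (1 : DirichletCharacter ℂ q) = q := hχ
    rw [DirichletCharacter.conductor_one] at h
    omega
  have hne : ∀ s : ℂ, 1 / 2 < s.re → LFunction χ s ≠ 0 := fun s hs h0 => by
    rcases lt_or_ge s.re 1 with h1 | h1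
    · exact hs.ne' (hGRH s h0 (by linarith) h1)
    · exact LFunction_ne_zero_of_one_le_re χ (Or.inl hχ1) h1 h0
  obtain ⟨l, hd, hexp, hsum⟩ := exists_log_LFunction hχ1 (by norm_num) hne
  set P : ℝ := Real.pi ^ 2 / 6 * Real.exp (-Real.eulerMascheroniConstant) *
    ∏ p ∈ q.primeFactors, ((p : ℝ) + 1) / p with hP
  have hP0 : 0 < P := by
    refine mul_pos (by positivity) (prod_pos fun p hp => ?_)
    have := (Nat.prime_of_mem_primeFactors hp).pos
    positivity
  set κ : ℝ := 2 * ε / (3 * P) with hκ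
  have hκ0 : 0 < κ := by positivity
  set a : ℝ := Real.exp (-κ) / 2 with ha
  have ha0 : 0 < a := by positivity
  have ha1 : a < 1 / 2 := by
    have : Real.exp (-κ) < 1 := Real.exp_lt_one_iff.2 (by linarith)
    rw [ha]
    linarith
  set A : ℝ := max 1 (6 * Real.exp 3 / κ)
  have hA1 : 1 ≤ A := le_max_left _ _
  have hA2 : 6 * Real.exp 3 / A ≤ κ :=
    div_le_of_le_mul₀ (by linarith) hκ0.le ((div_le_iff₀' hκ0).1 (le_max_right _ _))
  have hll : Filter.Tendsto (fun τ : ℝ => Real.log (Real.log τ)) Filter.atTop Filter.atTop :=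
    Real.tendsto_log_atTop.comp Real.tendsto_log_atTop
  have hX : Filter.Tendsto (fun τ : ℝ => (Real.log τ) ^ (1 / a)) Filter.atTop Filter.atTop :=
    (tendsto_rpow_atTop (by positivity)).comp Real.tendsto_log_atTop
  have hM := hX.eventually ((tendsto_sum_neg_log_one_add_inv_add_log_log q).eventually
    (lt_mem_nhds (sub_lt_self _ hκ0)))
  have hev := ((eventually_norm_log_sub_sum_charLogEuler_le hχ1 hd hexp hsum ha0 ha1 hA1).and
    (hM.and (hll.eventually_ge_atTop 1))).and (Filter.eventually_ge_atTop 4)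
  obtain ⟨T, hT⟩ := Filter.eventually_atTop.1 hev
  refine ⟨max 4 T, le_max_left _ _, fun ρ _ hρ1 hρT => ?_⟩
  obtain ⟨⟨h1, h2, hy1⟩, h4⟩ := hT ρ.im ((le_max_right _ _).trans hρT)
  have h1 := h1 ρ rfl hρ1
  set y := Real.log (Real.log ρ.im) with hy
  set X := (Real.log ρ.im) ^ (1 / a) with hXdef
  have hL : 1 < Real.log ρ.im := by
    rw [Real.lt_log_iff_exp_lt (by linarith)]
    linarith [Real.exp_one_lt_d9]
  have hy0 : 0 < y := by linarith
  have hllX : Real.log (Real.log X) = κ + Real.log 2 + Real.log y := by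
    rw [hXdef, Real.log_rpow (by linarith), ← hy, Real.log_mul (by positivity) hy0.ne', one_div,
      Real.log_inv, ha, Real.log_div (Real.exp_pos _).ne' two_ne_zero, Real.log_exp]
    ring
  have h5 := sum_neg_log_one_add_inv_le_re χ hρ1 ⌊X⌋₊
  have h6 := (abs_le.1 ((Complex.abs_re_le_norm _).trans (h1.trans hA2))).1
  rw [Complex.sub_re] at h6
  have h7 : Real.log P - 3 * κ - Real.log 2 - Real.log y ≤ (l ρ).re := by linarith
  have h8 := Real.exp_le_exp.2 h7
  rw [← Complex.norm_exp, hexp ρ (by linarith)] at h8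
  rw [Real.exp_sub, Real.exp_sub, Real.exp_sub, Real.exp_log hP0, Real.exp_log two_pos,
    Real.exp_log hy0, div_le_iff₀ hy0] at h8
  refine le_trans ?_ h8
  have h9 : 1 - 3 * κ ≤ (Real.exp (3 * κ))⁻¹ := by
    rw [← Real.exp_neg]
    linarith [Real.add_one_le_exp (-(3 * κ))]
  have h10 : P * κ = 2 * ε / 3 := by
    rw [hκ]
    field_simp
  have h11 : P * (1 - 3 * κ) ≤ P * (Real.exp (3 * κ))⁻¹ := by gcongr
  have h12 : Real.pi ^ 2 * Real.exp (-Real.eulerMascheroniConstant) / 12 *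
      ∏ p ∈ q.primeFactors, ((p : ℝ) + 1) / p = P / 2 := by
    rw [hP]
    ring
  rw [h12, div_eq_mul_inv P (Real.exp (3 * κ))]
  linarith
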